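/- Let R be a left noetherian ring and let GI(C) denote the class of Gorenstein injective complexes in Ch(R). Then the following are equivalent: (1) the cotorsion pair (⊥GI(C), GI(C)) is perfect; (2) the class ⊥GI(C) is covering in Ch(R); (3) the class GI(C) is enveloping in Ch(R). -/

import Mathlib

open CategoryTheory CategoryTheory.Limits

universe u

section GenericDefs

variable {𝒜 : Type*} [Category 𝒜] [Abelian 𝒜]

/-- An object `G` of an abelian category is *Gorenstein injective* if it is a cycle object of
an exact (ℤ-indexed) complex of injective objects which stays exact under `Hom(I, -)` for
every injective object `I`. -/
def IsGorensteinInjective (G : 𝒜) : Prop :=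
  ∃ C : ChainComplex 𝒜 ℤ,
    (∀ n, Injective (C.X n)) ∧
    (∀ n, C.ExactAt n) ∧
    (∀ (I : 𝒜), Injective I → ∀ n,
      (((preadditiveCoyoneda.obj (Opposite.op I)).mapHomologicalComplex _).obj C).ExactAt n) ∧
    Nonempty (G ≅ kernel (C.d 0 (-1)))

/-- An object `G` is *Gorenstein projective* if it is a cycle object of an exact complex of
projectives which stays exact under `Hom(-, P)` for every projective `P`. -/
def IsGorensteinProjective (G : 𝒜) : Prop :=
  ∃ C : ChainComplex 𝒜 ℤ,
    (∀ n, Projective (C.X n)) ∧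
    (∀ n, C.ExactAt n) ∧
    (∀ (P : 𝒜), Projective P → ∀ n,
      (((preadditiveYoneda.obj P).mapHomologicalComplex _).obj C.op).ExactAt n) ∧
    Nonempty (G ≅ kernel (C.d 0 (-1)))

/-- `φ : G ⟶ X` is a `𝒞`-precover of `X`. -/
def IsPrecover (𝒞 : 𝒜 → Prop) {G X : 𝒜} (φ : G ⟶ X) : Prop :=
  𝒞 G ∧ ∀ (G' : 𝒜), 𝒞 G' → ∀ ψ : G' ⟶ X, ∃ h : G' ⟶ G, h ≫ φ = ψ

/-- `φ : G ⟶ X` is a `𝒞`-cover of `X`. -/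
def IsCover (𝒞 : 𝒜 → Prop) {G X : 𝒜} (φ : G ⟶ X) : Prop :=
  IsPrecover 𝒞 φ ∧ ∀ f : G ⟶ G, f ≫ φ = φ → IsIso f

/-- `φ : X ⟶ G` is a `𝒞`-preenvelope of `X`. -/
def IsPreenvelope (𝒞 : 𝒜 → Prop) {X G : 𝒜} (φ : X ⟶ G) : Prop :=
  𝒞 G ∧ ∀ (G' : 𝒜), 𝒞 G' → ∀ ψ : X ⟶ G', ∃ h : G ⟶ G', φ ≫ h = ψ

/-- `φ : X ⟶ G` is a `𝒞`-envelope of `X`. -/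
def IsEnvelope (𝒞 : 𝒜 → Prop) {X G : 𝒜} (φ : X ⟶ G) : Prop :=
  IsPreenvelope 𝒞 φ ∧ ∀ f : G ⟶ G, φ ≫ f = φ → IsIso f

/-- `Ext¹(X, Y) = 0`, expressed by the splitting of every extension of `X` by `Y`. -/
def Ext1Zero (X Y : 𝒜) : Prop :=
  ∀ (E : 𝒜) (i : Y ⟶ E) (p : E ⟶ X) (w : i ≫ p = 0),
    (ShortComplex.mk i p w).ShortExact → ∃ s : X ⟶ E, s ≫ p = 𝟙 X

/-- `ExtSucZero n X Y` says `Ext^(n+1)(X, Y) = 0`; defined by dimension shifting along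
short exact sequences `0 ⟶ Y ⟶ E ⟶ Y' ⟶ 0` with `E` injective. -/
def ExtSucZero : ℕ → 𝒜 → 𝒜 → Prop
  | 0, X, Y => Ext1Zero X Y
  | (n+1), X, Y => ∀ (E Y' : 𝒜) (i : Y ⟶ E) (p : E ⟶ Y') (w : i ≫ p = 0),
      (ShortComplex.mk i p w).ShortExact → Injective E → ExtSucZero n X Y'

/-- A special `𝒞`-precover: an epimorphism `φ : G ⟶ X` with `G ∈ 𝒞` arising in a short exact
sequence `0 ⟶ A ⟶ G ⟶ X ⟶ 0` with `Ext¹(G', A) = 0` for all `G' ∈ 𝒞`. -/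
def IsSpecialPrecover (𝒞 : 𝒜 → Prop) {G X : 𝒜} (φ : G ⟶ X) : Prop :=
  IsPrecover 𝒞 φ ∧ ∃ (A : 𝒜) (i : A ⟶ G) (w : i ≫ φ = 0),
    (ShortComplex.mk i φ w).ShortExact ∧ ∀ (G' : 𝒜), 𝒞 G' → Ext1Zero G' A

/-- The left `Ext¹`-orthogonal class `⊥𝒞` of a class of objects `𝒞`. -/
def leftOrthogonal {𝒜 : Type*} [Category 𝒜] [Abelian 𝒜] (𝒞 : 𝒜 → Prop) (X : 𝒜) : Prop :=
  ∀ Y : 𝒜, 𝒞 Y → Ext1Zero X Y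

/-- The right `Ext¹`-orthogonal class `𝒞⊥` of a class of objects `𝒞`. -/
def rightOrthogonal {𝒜 : Type*} [Category 𝒜] [Abelian 𝒜] (𝒞 : 𝒜 → Prop) (Y : 𝒜) : Prop :=
  ∀ X : 𝒜, 𝒞 X → Ext1Zero X Y

end GenericDefs


section Ext1

variable {𝒜 : Type*} [Category 𝒜] [Abelian 𝒜]

/-- A short exact sequence, given by its universal properties. -/
theorem shortExact_of_lift {Y M Z : 𝒜} (i : Y ⟶ M) (p : M ⟶ Z) (w : i ≫ p = 0) (hi : Mono i)
    (hp : Epi p) (hl : ∀ {A : 𝒜} (k : A ⟶ M), k ≫ p = 0 → ∃ l, l ≫ i = k) :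
    (ShortComplex.mk i p w).ShortExact where
  exact := ShortComplex.exact_of_f_is_kernel _
    (KernelFork.IsLimit.ofι' _ _ fun k hk => ⟨(hl k hk).choose, (hl k hk).choose_spec⟩)

theorem CategoryTheory.ShortComplex.ShortExact.exists_lift {Y M Z A : 𝒜} {i : Y ⟶ M} {p : M ⟶ Z}
    {w : i ≫ p = 0} (h : (ShortComplex.mk i p w).ShortExact) (k : A ⟶ M) (hk : k ≫ p = 0) :
    ∃ l, l ≫ i = k :=
  have := h.mono_f
  ⟨h.exact.lift k hk, h.exact.lift_f k hk⟩

theorem CategoryTheory.ShortComplex.ShortExact.exists_desc {Y M Z A : 𝒜} {i : Y ⟶ M} {p : M ⟶ Z}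
    {w : i ≫ p = 0} (h : (ShortComplex.mk i p w).ShortExact) (k : M ⟶ A) (hk : i ≫ k = 0) :
    ∃ l, p ≫ l = k :=
  have := h.epi_g
  ⟨h.exact.desc k hk, h.exact.g_desc k hk⟩

theorem shortExact_cokernel {X Y : 𝒜} (f : X ⟶ Y) [Mono f] :
    (ShortComplex.mk f (cokernel.π f) (cokernel.condition f)).ShortExact where
  exact := ShortComplex.exact_cokernel _

theorem shortExact_kernel {X Y : 𝒜} (f : X ⟶ Y) [Epi f] :
    (ShortComplex.mk (kernel.ι f) f (kernel.condition f)).ShortExact where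
  exact := ShortComplex.exact_kernel _

/-- Short exact sequences pull back along arbitrary morphisms to the right-hand term. -/
theorem shortExact_pullback {Y M Z X : 𝒜} {i : Y ⟶ M} {p : M ⟶ Z} {w : i ≫ p = 0}
    (h : (ShortComplex.mk i p w).ShortExact) (f : X ⟶ Z) :
    (ShortComplex.mk (pullback.lift i (0 : Y ⟶ X) (by rw [w, zero_comp])) (pullback.snd p f)
      (pullback.lift_snd _ _ _)).ShortExact := by
  have hi : Mono i := h.mono_f
  have : Epi p := h.epi_g
  refine shortExact_of_lift _ _ _ ?_ inferInstance fun k hk => ?_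
  · have := pullback.lift_fst i (0 : Y ⟶ X) (by rw [w, zero_comp] : i ≫ p = 0 ≫ f)
    rw [← this] at hi
    exact mono_of_mono _ (pullback.fst p f)
  · obtain ⟨l, hl⟩ := h.exists_lift (k ≫ pullback.fst p f) (by
      rw [Category.assoc, pullback.condition, ← Category.assoc, hk, zero_comp])
    refine ⟨l, pullback.hom_ext ?_ ?_⟩
    · rw [Category.assoc, pullback.lift_fst, hl]
    · rw [Category.assoc, pullback.lift_snd, hk, comp_zero]

theorem Ext1Zero.exists_lift {X Y M Z : 𝒜} (hXY : Ext1Zero X Y) {i : Y ⟶ M} {p : M ⟶ Z}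
    {w : i ≫ p = 0} (h : (ShortComplex.mk i p w).ShortExact) (f : X ⟶ Z) :
    ∃ g : X ⟶ M, g ≫ p = f := by
  obtain ⟨s, hs⟩ := hXY _ _ _ _ (shortExact_pullback h f)
  exact ⟨s ≫ pullback.fst p f, by
    rw [Category.assoc, pullback.condition, ← Category.assoc, hs, Category.id_comp]⟩

/-- A retraction of the inclusion splits a short exact sequence. -/
theorem exists_section_of_retraction {X Y M : 𝒜} {j : Y ⟶ M} {q : M ⟶ X} {w : j ≫ q = 0}
    (h : (ShortComplex.mk j q w).ShortExact) (r : M ⟶ Y) (hr : j ≫ r = 𝟙 Y) :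
    ∃ s : X ⟶ M, s ≫ q = 𝟙 X := by
  have : Epi q := h.epi_g
  obtain ⟨s, hs⟩ := h.exists_desc (𝟙 M - r ≫ j) (by
    rw [Preadditive.comp_sub, ← Category.assoc, hr, Category.comp_id, Category.id_comp, sub_self])
  refine ⟨s, ?_⟩
  rw [← cancel_epi q, ← Category.assoc, hs, Preadditive.sub_comp, Category.assoc, w]
  simp

theorem Ext1Zero.exists_extension [EnoughInjectives 𝒜] {X Y K L : 𝒜} (hXY : Ext1Zero X Y)
    {k : K ⟶ L} {p : L ⟶ X} {w : k ≫ p = 0} (h : (ShortComplex.mk k p w).ShortExact)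
    (f : K ⟶ Y) : ∃ g : L ⟶ Y, k ≫ g = f := by
  have : Mono k := h.mono_f
  have hY := shortExact_cokernel (Injective.ι Y)
  let a : L ⟶ Injective.under Y := Injective.factorThru (f ≫ Injective.ι Y) k
  have ha : k ≫ a = f ≫ Injective.ι Y := Injective.comp_factorThru _ _
  obtain ⟨e, he⟩ := h.exists_desc (a ≫ cokernel.π (Injective.ι Y)) (by
    rw [← Category.assoc, ha, Category.assoc, cokernel.condition, comp_zero])
  obtain ⟨t, ht⟩ := hXY.exists_lift hY e
  obtain ⟨g, hg⟩ := hY.exists_lift (a - p ≫ t) (by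
    rw [Preadditive.sub_comp, Category.assoc, ht, he, sub_self])
  refine ⟨g, ?_⟩
  rw [← cancel_mono (Injective.ι Y), Category.assoc, hg, Preadditive.comp_sub, ha,
    ← Category.assoc, w, zero_comp, sub_zero]

/-- `Ext¹(X, Y)` vanishes if every morphism from `X` to a cosyzygy of `Y` lifts. -/
theorem ext1Zero_of_lift {X Y E Z : 𝒜} [Injective E] {i : Y ⟶ E} {p : E ⟶ Z} {w : i ≫ p = 0}
    (h : (ShortComplex.mk i p w).ShortExact) (hl : ∀ f : X ⟶ Z, ∃ g : X ⟶ E, g ≫ p = f) :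
    Ext1Zero X Y := by
  intro M j q w' h'
  have : Mono j := h'.mono_f
  have : Mono i := h.mono_f
  let a : M ⟶ E := Injective.factorThru i j
  have ha : j ≫ a = i := Injective.comp_factorThru _ _
  obtain ⟨e, he⟩ := h'.exists_desc (a ≫ p) (by rw [← Category.assoc, ha, w])
  obtain ⟨t, ht⟩ := hl e
  obtain ⟨r, hr⟩ := h.exists_lift (a - q ≫ t) (by
    rw [Preadditive.sub_comp, Category.assoc, ht, he, sub_self])
  refine exists_section_of_retraction h' r ?_
  rw [← cancel_mono i, Category.assoc, hr, Preadditive.comp_sub, ha, ← Category.assoc, w']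
  simp

/-- `Ext¹(X, Y)` vanishes if every morphism from a syzygy of `X` to `Y` extends. -/
theorem ext1Zero_of_extension {X Y P K : 𝒜} [Projective P] {k : K ⟶ P} {p : P ⟶ X}
    {w : k ≫ p = 0} (h : (ShortComplex.mk k p w).ShortExact)
    (hl : ∀ f : K ⟶ Y, ∃ g : P ⟶ Y, k ≫ g = f) : Ext1Zero X Y := by
  intro M j q w' h'
  have : Epi q := h'.epi_g
  have : Epi p := h.epi_g
  let a : P ⟶ M := Projective.factorThru p q
  have ha : a ≫ q = p := Projective.factorThru_comp _ _
  obtain ⟨e, he⟩ := h'.exists_lift (k ≫ a) (by rw [Category.assoc, ha, w])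
  obtain ⟨t, ht⟩ := hl e
  obtain ⟨s, hs⟩ := h.exists_desc (a - t ≫ j) (by
    rw [Preadditive.comp_sub, ← Category.assoc, ht, he, sub_self])
  refine ⟨s, ?_⟩
  rw [← cancel_epi p, ← Category.assoc, hs, Preadditive.sub_comp, Category.assoc, w', ha]
  simp

theorem ext1Zero_of_projective {P Y : 𝒜} [Projective P] : Ext1Zero P Y := by
  intro M j q w h
  have : Epi q := h.epi_g
  exact ⟨Projective.factorThru (𝟙 P) q, Projective.factorThru_comp _ _⟩

theorem ext1Zero_of_injective {X E : 𝒜} [Injective E] : Ext1Zero X E := by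
  intro M j q w h
  have : Mono j := h.mono_f
  exact exists_section_of_retraction h (Injective.factorThru (𝟙 E) j)
    (Injective.comp_factorThru _ _)

/-- `Ext¹(X, -) = 0` passes to extensions. -/
theorem Ext1Zero.of_extension [EnoughInjectives 𝒜] {X A B C : 𝒜} {i : A ⟶ B} {p : B ⟶ C}
    {w : i ≫ p = 0} (h : (ShortComplex.mk i p w).ShortExact) (hA : Ext1Zero X A)
    (hC : Ext1Zero X C) : Ext1Zero X B := by
  intro M j q w' h'
  have : Mono i := h.mono_f
  have hp : Epi p := h.epi_g
  have : Mono j := h'.mono_f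
  have : Epi q := h'.epi_g
  obtain ⟨t, ht⟩ := hC.exists_extension h' p
  have : Epi t := by
    rw [← ht] at hp
    exact epi_of_epi j t
  obtain ⟨i', hi'⟩ : ∃ i', i' ≫ kernel.ι t = i ≫ j := ⟨kernel.lift t (i ≫ j) (by
    rw [Category.assoc, ht, w]), kernel.lift_ι _ _ _⟩
  have hm : Mono (i' ≫ kernel.ι t) := by
    rw [hi']
    infer_instance
  have hS := shortExact_of_lift i' (kernel.ι t ≫ q) (by
      rw [← Category.assoc, hi', Category.assoc, w', comp_zero])
    (mono_of_mono i' (kernel.ι t)) (Preadditive.epi_of_cancel_zero _ fun z hz => by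
      obtain ⟨y, hy⟩ := (shortExact_kernel t).exists_desc (q ≫ z) (by rw [← hz, Category.assoc])
      have : y = 0 := by
        rw [← cancel_epi p, ← ht, Category.assoc, hy, ← Category.assoc, w', zero_comp, comp_zero]
      rw [← cancel_epi q, ← hy, this, comp_zero, comp_zero]) fun k hk => by
      obtain ⟨a, ha⟩ := h'.exists_lift (k ≫ kernel.ι t) (by rw [← hk, Category.assoc])
      obtain ⟨b, hb⟩ := h.exists_lift a (by
        rw [← ht, ← Category.assoc, ha, Category.assoc, kernel.condition, comp_zero])
      refine ⟨b, ?_⟩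
      rw [← cancel_mono (kernel.ι t), Category.assoc, hi', ← Category.assoc, hb, ha]
  obtain ⟨s, hs⟩ := hA _ _ _ _ hS
  exact ⟨s ≫ kernel.ι t, by rw [Category.assoc, hs]⟩

/-- `Ext¹(X, -) = 0` passes to retracts. -/
theorem Ext1Zero.of_retract [EnoughInjectives 𝒜] {X Y Y' : 𝒜} (hY : Ext1Zero X Y)
    (a : Y' ⟶ Y) (b : Y ⟶ Y') (hab : a ≫ b = 𝟙 Y') : Ext1Zero X Y' := by
  intro M j q w h
  obtain ⟨g, hg⟩ := hY.exists_extension h a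
  exact exists_section_of_retraction h (g ≫ b) (by rw [← Category.assoc, hg, hab])

end Ext1

section GorensteinInjective

variable {𝒜 : Type*} [Category 𝒜] [Abelian 𝒜]

/-- There is a short exact sequence `0 ⟶ A ⟶ E ⟶ B ⟶ 0` with `E` injective. -/
def InjStep (A B : 𝒜) : Prop :=
  ∃ (E : 𝒜) (i : A ⟶ E) (p : E ⟶ B) (w : i ≫ p = 0),
    (ShortComplex.mk i p w).ShortExact ∧ Injective E

/-- A class of objects closed under taking suitable injective steps in both directions;
every such class consists of Gorenstein injective objects. -/
structure IsGorensteinInjectiveClass (𝒢 : 𝒜 → Prop) : Prop where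
  ext1Zero : ∀ I G, Injective I → 𝒢 G → Ext1Zero I G
  left : ∀ G, 𝒢 G → ∃ G', 𝒢 G' ∧ InjStep G' G
  right : ∀ G, 𝒢 G → ∃ G', 𝒢 G' ∧ InjStep G G'

theorem InjStep.congr_iso {A A' B B' : 𝒜} (h : InjStep A B) (a : A ≅ A') (b : B ≅ B') :
    InjStep A' B' := by
  obtain ⟨E, i, p, w, h, hE⟩ := h
  have := h.mono_f
  have := h.epi_g
  dsimp at *
  refine ⟨E, a.inv ≫ i, p ≫ b.hom, by simp [reassoc_of% w], shortExact_of_lift _ _ _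
    inferInstance inferInstance fun k hk => ?_, hE⟩
  obtain ⟨l, hl⟩ := h.exists_lift k (by
    rw [← cancel_mono b.hom, Category.assoc, hk, zero_comp])
  exact ⟨l ≫ a.hom, by simpa using hl⟩

theorem exactAt_shortExact {C : ChainComplex 𝒜 ℤ} (hC : ∀ n, C.ExactAt n) {i j k : ℤ}
    (hij : j + 1 = i) (hjk : k + 1 = j) :
    (ShortComplex.mk (kernel.ι (C.d i j))
      (kernel.lift (C.d j k) (C.d i j) (C.d_comp_d _ _ _)) (by
        rw [← cancel_mono (kernel.ι _)]; simp)).ShortExact := by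
  have hex := (C.exactAt_iff' i j k ((ComplexShape.down ℤ).prev_eq' hij)
    ((ComplexShape.down ℤ).next_eq' hjk)).1 (hC j)
  have : Epi (kernel.lift (C.d j k) (C.d i j) (C.d_comp_d _ _ _)) := by
    have := (ShortComplex.exact_iff_epi_kernel_lift _).1 hex
    exact this
  refine shortExact_of_lift _ _ _ inferInstance this fun l hl => ?_
  refine ⟨kernel.lift _ l ?_, kernel.lift_ι _ _ _⟩
  have := congr($hl ≫ kernel.ι _)
  simpa using this

theorem isGorensteinInjectiveClass_kernels {C : ChainComplex 𝒜 ℤ}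
    (hinj : ∀ n, Injective (C.X n)) (hC : ∀ n, C.ExactAt n)
    (hI : ∀ (I : 𝒜), Injective I → ∀ n,
      (((preadditiveCoyoneda.obj (Opposite.op I)).mapHomologicalComplex _).obj C).ExactAt n) :
    IsGorensteinInjectiveClass fun G => ∃ i j : ℤ, j + 1 = i ∧ Nonempty (G ≅ kernel (C.d i j)) where
  ext1Zero I G hI' := by
    rintro ⟨i, j, hij, ⟨e⟩⟩
    obtain ⟨E, a, p, w, h, hE⟩ : InjStep G (kernel (C.d j (j - 1))) :=
      InjStep.congr_iso ⟨_, _, _, _, exactAt_shortExact hC hij (sub_add_cancel j 1), hinj _⟩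
        e.symm (Iso.refl _)
    have := hinj i
    have h0 : Ext1Zero I (kernel (C.d i j)) := by
      refine ext1Zero_of_lift (exactAt_shortExact hC hij (sub_add_cancel j 1)) fun f => ?_
      have hex := (HomologicalComplex.exactAt_iff' _ i j (j - 1)
        ((ComplexShape.down ℤ).prev_eq' hij)
        ((ComplexShape.down ℤ).next_eq' (sub_add_cancel j 1))).1 (hI I hI' j)
      obtain ⟨g, hg⟩ := (ShortComplex.ab_exact_iff _).1 hex (f ≫ kernel.ι _) (by
        change (f ≫ kernel.ι _) ≫ C.d j (j - 1) = 0
        rw [Category.assoc, kernel.condition, comp_zero])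
      change I ⟶ C.X i at g
      change g ≫ C.d i j = _ at hg
      exact ⟨g, by rw [← cancel_mono (kernel.ι _)]; simpa using hg⟩
    intro M q r w' h'
    have := h'.mono_f
    have := h'.epi_g
    dsimp at *
    refine h0 M (e.inv ≫ q) r (by rw [Category.assoc, w', comp_zero]) (shortExact_of_lift _ _ _
      inferInstance inferInstance fun k hk => ?_)
    obtain ⟨l, hl⟩ := h'.exists_lift k hk
    exact ⟨l ≫ e.hom, by simpa using hl⟩
  left G := by
    rintro ⟨i, j, rfl, ⟨e⟩⟩
    exact ⟨_, ⟨_, _, rfl, ⟨Iso.refl _⟩⟩,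
      InjStep.congr_iso ⟨_, _, _, _, exactAt_shortExact hC rfl rfl, hinj _⟩ (Iso.refl _) e.symm⟩
  right G := by
    rintro ⟨i, j, hij, ⟨e⟩⟩
    exact ⟨_, ⟨_, _, sub_add_cancel j 1, ⟨Iso.refl _⟩⟩, InjStep.congr_iso
      ⟨_, _, _, _, exactAt_shortExact hC hij (sub_add_cancel j 1), hinj _⟩ e.symm (Iso.refl _)⟩

/-- A relation with predecessors and successors admits a bi-infinite path through every point. -/
theorem exists_int_path {α : Type*} (r : α → α → Prop) (hl : ∀ a, ∃ b, r b a)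
    (hr : ∀ a, ∃ b, r a b) (a : α) : ∃ f : ℤ → α, f 0 = a ∧ ∀ n, r (f (n + 1)) (f n) := by
  choose L hL using hl
  choose R hR using hr
  refine ⟨fun n => n.rec (fun k => L^[k] a) fun k => R^[k + 1] a, rfl, fun n => ?_⟩
  rcases n with k | _ | k
  · change r (L^[k + 1] a) (L^[k] a)
    rw [Function.iterate_succ_apply']
    exact hL _
  · exact hR _
  · change r (R^[k + 1] a) (R^[k + 2] a)
    rw [Function.iterate_succ_apply' _ (k + 1)]
    exact hR _

theorem isGorensteinInjective_of_path {A : ℤ → 𝒜} (hA : ∀ n, InjStep (A (n + 1)) (A n))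
    (hI : ∀ I n, Injective I → Ext1Zero I (A n)) : IsGorensteinInjective (A 1) := by
  choose E i p w h hE using hA
  have hm : ∀ n, Mono (i n) := fun n => (h n).mono_f
  have he : ∀ n, Epi (p n) := fun n => (h n).epi_g
  let C : ChainComplex 𝒜 ℤ := ChainComplex.of E (fun n => p (n + 1) ≫ i n) fun n => by
    simp [reassoc_of% (w (n + 1))]
  have hd : ∀ n, C.d (n + 1) n = p (n + 1) ≫ i n :=
    fun n => ChainComplex.of_d E (fun n => p (n + 1) ≫ i n) n
  have key : ∀ (X : 𝒜) (n : ℤ) (f : X ⟶ E (n + 1)), f ≫ p (n + 1) ≫ i n = 0 →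
      ∃ g, g ≫ i (n + 1) = f := fun X n f hf => (h _).exists_lift f (by
    rw [← cancel_mono (i n), Category.assoc, hf, zero_comp])
  refine ⟨C, hE, fun n => ?_, fun I hI' n => ?_, ?_⟩
  · obtain ⟨n, rfl⟩ : ∃ m, n = m + 1 := ⟨n - 1, (sub_add_cancel n 1).symm⟩
    rw [C.exactAt_iff' (n + 1 + 1) (n + 1) n ((ComplexShape.down ℤ).prev_eq' rfl)
      ((ComplexShape.down ℤ).next_eq' rfl), ShortComplex.exact_iff_exact_up_to_refinements]
    intro X f hf
    change X ⟶ E (n + 1) at f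
    change f ≫ C.d (n + 1) n = 0 at hf
    rw [hd] at hf
    obtain ⟨g, hg⟩ := key X n f hf
    refine ⟨_, pullback.fst g (p (n + 1 + 1)), inferInstance, pullback.snd _ _, ?_⟩
    change _ = _ ≫ C.d _ _
    rw [hd, ← Category.assoc, ← pullback.condition, Category.assoc, hg]
    rfl
  · obtain ⟨n, rfl⟩ : ∃ m, n = m + 1 := ⟨n - 1, (sub_add_cancel n 1).symm⟩
    rw [HomologicalComplex.exactAt_iff' _ (n + 1 + 1) (n + 1) n
      ((ComplexShape.down ℤ).prev_eq' rfl) ((ComplexShape.down ℤ).next_eq' rfl),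
      ShortComplex.ab_exact_iff]
    intro f hf
    change I ⟶ E (n + 1) at f
    change f ≫ C.d (n + 1) n = 0 at hf
    rw [hd] at hf
    obtain ⟨g, hg⟩ := key I n f hf
    obtain ⟨g', hg'⟩ := (hI I _ hI').exists_lift (h (n + 1 + 1)) g
    refine ⟨g', ?_⟩
    change g' ≫ C.d _ _ = f
    rw [hd, ← Category.assoc, hg', hg]
  · have : ∀ m n : ℤ, n + 1 = m → Nonempty (A (m + 1) ≅ kernel (C.d m n)) := by
      rintro _ n rfl
      have hw : i (n + 1) ≫ C.d (n + 1) n = 0 := by rw [hd, ← Category.assoc, w, zero_comp]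
      exact ⟨IsLimit.conePointUniqueUpToIso (KernelFork.IsLimit.ofι' (i (n + 1)) hw fun k hk =>
        ⟨_, (key _ n k (by rw [← hd]; exact hk)).choose_spec⟩) (limit.isLimit _)⟩
    exact this 0 (-1) rfl

theorem IsGorensteinInjectiveClass.isGorensteinInjective {𝒢 : 𝒜 → Prop}
    (h𝒢 : IsGorensteinInjectiveClass 𝒢) {G : 𝒜} (hG : 𝒢 G) : IsGorensteinInjective G := by
  obtain ⟨f, hf, hA⟩ := exists_int_path (fun a b : {G // 𝒢 G} => InjStep a.1 b.1)
    (fun a => let ⟨b, hb, h⟩ := h𝒢.left _ a.2; ⟨⟨b, hb⟩, h⟩)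
    (fun a => let ⟨b, hb, h⟩ := h𝒢.right _ a.2; ⟨⟨b, hb⟩, h⟩) ⟨G, hG⟩
  have := isGorensteinInjective_of_path (A := fun n => (f (n - 1)).1) (fun n => by
    have := hA (n - 1)
    rwa [sub_add_eq_add_sub] at this) fun I n hI => h𝒢.ext1Zero _ _ hI (f _).2
  simpa [hf] using this

theorem isGorensteinInjectiveClass_isGorensteinInjective :
    IsGorensteinInjectiveClass (IsGorensteinInjective (𝒜 := 𝒜)) := by
  have key : ∀ G : 𝒜, IsGorensteinInjective G → ∃ 𝒢, IsGorensteinInjectiveClass 𝒢 ∧ 𝒢 G :=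
    fun G ⟨C, h₁, h₂, h₃, e⟩ =>
      ⟨_, isGorensteinInjectiveClass_kernels h₁ h₂ h₃, 0, -1, rfl, e⟩
  refine ⟨fun I G hI hG => ?_, fun G hG => ?_, fun G hG => ?_⟩ <;>
    obtain ⟨𝒢, h𝒢, hG⟩ := key G hG
  · exact h𝒢.ext1Zero I G hI hG
  · exact (h𝒢.left G hG).imp fun _ h => ⟨h𝒢.isGorensteinInjective h.1, h.2⟩
  · exact (h𝒢.right G hG).imp fun _ h => ⟨h𝒢.isGorensteinInjective h.1, h.2⟩

theorem isGorensteinInjective_of_injective {G : 𝒜} [hG : Injective G] :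
    IsGorensteinInjective G := by
  have hid : ∀ E : 𝒜, Injective E → ∃ G', Injective G' ∧ InjStep G' E := fun E _ =>
    ⟨kernel (𝟙 E), (isZero_kernel_of_mono (𝟙 E)).injective, E, _, _, _, shortExact_kernel (𝟙 E),
      inferInstance⟩
  have hid' : ∀ E : 𝒜, Injective E → ∃ G', Injective G' ∧ InjStep E G' := fun E _ =>
    ⟨cokernel (𝟙 E), (isZero_cokernel_of_epi (𝟙 E)).injective, E, _, _, _,
      shortExact_cokernel (𝟙 E), inferInstance⟩
  exact IsGorensteinInjectiveClass.isGorensteinInjective (𝒢 := fun G => Injective G)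
    ⟨fun _ _ _ _ => ext1Zero_of_injective, hid, hid'⟩ hG

theorem exists_epi_refinement {X Y T : 𝒜} (p : X ⟶ Y) [Epi p] (y : T ⟶ Y) :
    ∃ (T' : 𝒜) (e : T' ⟶ T) (_ : Epi e) (x : T' ⟶ X), x ≫ p = e ≫ y :=
  ⟨_, pullback.snd p y, inferInstance, pullback.fst p y, pullback.condition⟩

/-- The horseshoe lemma for a short exact sequence whose outer terms are quotients of
`E` and `E'`. -/
theorem horseshoe_left {A B C A' C' E E' : 𝒜} {i : A ⟶ B} {p : B ⟶ C} {w : i ≫ p = 0}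
    (h : (ShortComplex.mk i p w).ShortExact) {a : A' ⟶ E} {q : E ⟶ A} {wa : a ≫ q = 0}
    (hA : (ShortComplex.mk a q wa).ShortExact) {c : C' ⟶ E'} {r : E' ⟶ C} {wc : c ≫ r = 0}
    (hC : (ShortComplex.mk c r wc).ShortExact) (t : E' ⟶ B) (ht : t ≫ p = r) :
    ∃ (K : 𝒜) (k : K ⟶ E ⊞ E') (s : E ⊞ E' ⟶ B) (w₁ : k ≫ s = 0) (f : A' ⟶ K) (g : K ⟶ C')
      (w₂ : f ≫ g = 0), (ShortComplex.mk k s w₁).ShortExact ∧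
        (ShortComplex.mk f g w₂).ShortExact := by
  have hi : Mono i := h.mono_f
  have hp : Epi p := h.epi_g
  have ha : Mono a := hA.mono_f
  have hq : Epi q := hA.epi_g
  have hc : Mono c := hC.mono_f
  have hr : Epi r := hC.epi_g
  let s : E ⊞ E' ⟶ B := biprod.desc (q ≫ i) t
  have hsp : s ≫ p = biprod.snd ≫ r := by
    ext <;> simp [s, w, ht]
  have hs : Epi s := Preadditive.epi_of_cancel_zero _ fun {Z} z hz => by
    have h1 : i ≫ z = 0 := by
      rw [← cancel_epi q]
      simpa [s] using congr(biprod.inl ≫ $hz)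
    obtain ⟨y, rfl⟩ := h.exists_desc z h1
    have h2 : y = 0 := by
      rw [← cancel_epi r, ← ht]
      simpa [s] using congr(biprod.inr ≫ $hz)
    rw [h2, comp_zero]
  obtain ⟨g, hg⟩ := hC.exists_lift (kernel.ι s ≫ biprod.snd) (by
    rw [Category.assoc, ← hsp, ← Category.assoc, kernel.condition, zero_comp])
  let f : A' ⟶ kernel s := kernel.lift s (a ≫ biprod.inl) (by simp [s, reassoc_of% wa])
  have hf : f ≫ kernel.ι s = a ≫ biprod.inl := kernel.lift_ι _ _ _
  have w₂ : f ≫ g = 0 := by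
    rw [← cancel_mono c, Category.assoc, hg, ← Category.assoc, hf]
    simp
  have hfm : Mono (f ≫ kernel.ι s) := by
    rw [hf]
    infer_instance
  refine ⟨kernel s, kernel.ι s, s, kernel.condition s, f, g, w₂, shortExact_kernel s,
    shortExact_of_lift f g w₂ (mono_of_mono f (kernel.ι s)) ?_ ?_⟩
  · refine (epi_iff_surjective_up_to_refinements g).2 fun {T} y => ?_
    obtain ⟨x, hx⟩ := h.exists_lift (y ≫ c ≫ t) (by simp [ht, wc])
    obtain ⟨T', e, he, z, hz⟩ := exists_epi_refinement q x
    refine ⟨T', e, he, kernel.lift s (biprod.lift (-z) (e ≫ y ≫ c)) ?_, ?_⟩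
    · simp [s, reassoc_of% hz, hx]
    · rw [← cancel_mono c]
      simp [hg]
  · intro T k hk
    have h1 : k ≫ kernel.ι s ≫ biprod.snd = 0 := by rw [← hg, ← Category.assoc, hk, zero_comp]
    have h2 : k ≫ kernel.ι s = (k ≫ kernel.ι s ≫ biprod.fst) ≫ biprod.inl := by
      ext <;> simp [h1]
    obtain ⟨l, hl⟩ := hA.exists_lift (k ≫ kernel.ι s ≫ biprod.fst) (by
      have := congr($h2 ≫ s)
      rw [← cancel_mono i]
      simpa [s] using this.symm)
    refine ⟨l, ?_⟩
    rw [← cancel_mono (kernel.ι s), Category.assoc, hf, h2, ← hl, Category.assoc]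

/-- The horseshoe lemma for a short exact sequence whose outer terms are subobjects of
`E` and `E'`. -/
theorem horseshoe_right {A B C A' C' E E' : 𝒜} {i : A ⟶ B} {p : B ⟶ C} {w : i ≫ p = 0}
    (h : (ShortComplex.mk i p w).ShortExact) {a : A ⟶ E} {q : E ⟶ A'} {wa : a ≫ q = 0}
    (hA : (ShortComplex.mk a q wa).ShortExact) {c : C ⟶ E'} {r : E' ⟶ C'} {wc : c ≫ r = 0}
    (hC : (ShortComplex.mk c r wc).ShortExact) (t : B ⟶ E) (ht : i ≫ t = a) :
    ∃ (K : 𝒜) (k : B ⟶ E ⊞ E') (s : E ⊞ E' ⟶ K) (w₁ : k ≫ s = 0) (f : A' ⟶ K) (g : K ⟶ C')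
      (w₂ : f ≫ g = 0), (ShortComplex.mk k s w₁).ShortExact ∧
        (ShortComplex.mk f g w₂).ShortExact := by
  have hi : Mono i := h.mono_f
  have hp : Epi p := h.epi_g
  have ha : Mono a := hA.mono_f
  have hq : Epi q := hA.epi_g
  have hc : Mono c := hC.mono_f
  have hr : Epi r := hC.epi_g
  let m : B ⟶ E ⊞ E' := biprod.lift t (p ≫ c)
  have him : i ≫ m = a ≫ biprod.inl := by
    ext <;> simp [m, reassoc_of% w, ht]
  have hm : Mono m := Preadditive.mono_of_cancel_zero _ fun {Z} z hz => by
    have h1 : z ≫ p = 0 := by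
      rw [← cancel_mono c]
      simpa [m] using congr($hz ≫ biprod.snd)
    obtain ⟨y, rfl⟩ := h.exists_lift z h1
    have h2 : y = 0 := by
      rw [← cancel_mono a, ← ht]
      simpa [m] using congr($hz ≫ biprod.fst)
    rw [h2, zero_comp]
  obtain ⟨f, hf⟩ := hA.exists_desc (biprod.inl ≫ cokernel.π m) (by
    rw [← Category.assoc, ← him, Category.assoc, cokernel.condition, comp_zero])
  let g : cokernel m ⟶ C' := cokernel.desc m (biprod.snd ≫ r) (by simp [m, wc])
  have hg : cokernel.π m ≫ g = biprod.snd ≫ r := cokernel.π_desc _ _ _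
  have w₂ : f ≫ g = 0 := by
    rw [← cancel_epi q, ← Category.assoc, hf, Category.assoc, hg]
    simp
  have hge : Epi (cokernel.π m ≫ g) := by
    rw [hg]
    infer_instance
  have hS := shortExact_cokernel m
  have hfm : Mono f := Preadditive.mono_of_cancel_zero _ fun {T} y hy => by
    obtain ⟨T', e, he, x, hx⟩ := exists_epi_refinement q y
    obtain ⟨b, hb⟩ := hS.exists_lift (x ≫ biprod.inl) (by
      rw [Category.assoc, ← hf, reassoc_of% hx, hy, comp_zero])
    obtain ⟨z, rfl⟩ := h.exists_lift b (by
      rw [← cancel_mono c]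
      simpa [m] using congr($hb ≫ biprod.snd))
    have hz : z ≫ a = x := by
      simpa [m, ht] using congr($hb ≫ biprod.fst)
    rw [← cancel_epi e, ← hx, ← hz, Category.assoc, wa, comp_zero, comp_zero]
  refine ⟨cokernel m, m, cokernel.π m, cokernel.condition m, f, g, w₂, hS,
    { exact := ?_, epi_g := epi_of_epi (cokernel.π m) g }⟩
  refine (ShortComplex.exact_iff_exact_up_to_refinements _).2 fun T k hk => ?_
  change T ⟶ cokernel m at k
  change k ≫ g = 0 at hk
  obtain ⟨T', e, he, y, hy⟩ := exists_epi_refinement (cokernel.π m) k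
  obtain ⟨z, hz⟩ := hC.exists_lift (y ≫ biprod.snd) (by
    rw [Category.assoc, ← hg, reassoc_of% hy, hk, comp_zero])
  obtain ⟨T'', e', he', b, hb⟩ := exists_epi_refinement p z
  refine ⟨T'', e' ≫ e, inferInstance, (e' ≫ y - b ≫ m) ≫ biprod.fst ≫ q, ?_⟩
  have h1 : (e' ≫ y - b ≫ m) ≫ biprod.fst ≫ biprod.inl = e' ≫ y - b ≫ m := by
    ext
    · simp
    · simp [m, reassoc_of% hb, hz]
  change (e' ≫ e) ≫ k = (_ ≫ _ ≫ q) ≫ f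
  have h2 : ((e' ≫ y - b ≫ m) ≫ biprod.fst ≫ q) ≫ f =
      ((e' ≫ y - b ≫ m) ≫ biprod.fst ≫ biprod.inl) ≫ cokernel.π m := by
    simp only [Category.assoc, hf]
  rw [h2, h1, Preadditive.sub_comp, Category.assoc, Category.assoc, Category.assoc,
    cokernel.condition, comp_zero, sub_zero, hy]

/-- Gorenstein injective objects are closed under extensions. -/
theorem IsGorensteinInjective.of_extension [EnoughInjectives 𝒜] {A B C : 𝒜} {i : A ⟶ B}
    {p : B ⟶ C} {w : i ≫ p = 0} (h : (ShortComplex.mk i p w).ShortExact)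
    (hA : IsGorensteinInjective A) (hC : IsGorensteinInjective C) : IsGorensteinInjective B := by
  have hGI := isGorensteinInjectiveClass_isGorensteinInjective (𝒜 := 𝒜)
  refine IsGorensteinInjectiveClass.isGorensteinInjective (𝒢 := fun B => ∃ (A C : 𝒜)
    (i : A ⟶ B) (p : B ⟶ C) (w : i ≫ p = 0), (ShortComplex.mk i p w).ShortExact ∧
      IsGorensteinInjective A ∧ IsGorensteinInjective C) ⟨?_, ?_, ?_⟩ ⟨A, C, i, p, w, h, hA, hC⟩
  · rintro I B hI ⟨A, C, i, p, w, h, hA, hC⟩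
    exact .of_extension h (hGI.ext1Zero I A hI hA) (hGI.ext1Zero I C hI hC)
  · rintro B ⟨A, C, i, p, w, h, hA, hC⟩
    obtain ⟨A', hA', E, a, q, wa, ha, hE⟩ := hGI.left A hA
    obtain ⟨C', hC', E', c, r, wc, hc, hE'⟩ := hGI.left C hC
    obtain ⟨t, ht⟩ := (hGI.ext1Zero E' A hE' hA).exists_lift h r
    obtain ⟨K, k, s, w₁, f, g, w₂, h₁, h₂⟩ := horseshoe_left h ha hc t ht
    exact ⟨K, ⟨A', C', f, g, w₂, h₂, hA', hC'⟩, _, k, s, w₁, h₁, inferInstance⟩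
  · rintro B ⟨A, C, i, p, w, h, hA, hC⟩
    obtain ⟨A', hA', E, a, q, wa, ha, hE⟩ := hGI.right A hA
    obtain ⟨C', hC', E', c, r, wc, hc, hE'⟩ := hGI.right C hC
    have : Mono i := h.mono_f
    obtain ⟨K, k, s, w₁, f, g, w₂, h₁, h₂⟩ := horseshoe_right h ha hc
      (Injective.factorThru a i) (Injective.comp_factorThru _ _)
    exact ⟨K, ⟨A', C', f, g, w₂, h₂, hA', hC'⟩, _, k, s, w₁, h₁, inferInstance⟩

end GorensteinInjective

section LeftOrthogonal

variable {𝒜 : Type*} [Category 𝒜] [Abelian 𝒜]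

theorem leftOrthogonal_of_injective {I : 𝒜} [Injective I] :
    leftOrthogonal IsGorensteinInjective I := fun G hG =>
  isGorensteinInjectiveClass_isGorensteinInjective.ext1Zero I G inferInstance hG

theorem leftOrthogonal_of_projective {𝒞 : 𝒜 → Prop} {P : 𝒜} [Projective P] :
    leftOrthogonal 𝒞 P := fun _ _ => ext1Zero_of_projective

theorem leftOrthogonal_of_lift {X : 𝒜}
    (hX : ∀ {Y E Z : 𝒜} {i : Y ⟶ E} {p : E ⟶ Z} {w : i ≫ p = 0},
      (ShortComplex.mk i p w).ShortExact → Injective E → IsGorensteinInjective Y →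
      IsGorensteinInjective Z → ∀ f : X ⟶ Z, ∃ g : X ⟶ E, g ≫ p = f) :
    leftOrthogonal IsGorensteinInjective X := by
  intro Y hY
  obtain ⟨Z, hZ, E, i, p, w, h, hE⟩ :=
    isGorensteinInjectiveClass_isGorensteinInjective.right Y hY
  exact ext1Zero_of_lift h fun f => hX h hE hY hZ f

theorem leftOrthogonal_of_extension {A B C : 𝒜} {i : A ⟶ B} {p : B ⟶ C} {w : i ≫ p = 0}
    (h : (ShortComplex.mk i p w).ShortExact) (hA : leftOrthogonal IsGorensteinInjective A)
    (hC : leftOrthogonal IsGorensteinInjective C) : leftOrthogonal IsGorensteinInjective B := by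
  have : Mono i := h.mono_f
  refine leftOrthogonal_of_lift fun {Y E Z j q w'} h' hE hY _ f => ?_
  obtain ⟨a, ha⟩ := (hA Y hY).exists_lift h' (i ≫ f)
  obtain ⟨c, hc⟩ := h.exists_desc (f - Injective.factorThru a i ≫ q) (by
    rw [Preadditive.comp_sub, ← Category.assoc, Injective.comp_factorThru, ha, sub_self])
  obtain ⟨d, hd⟩ := (hC Y hY).exists_lift h' c
  exact ⟨p ≫ d + Injective.factorThru a i, by
    rw [Preadditive.add_comp, Category.assoc, hd, hc, sub_add_cancel]⟩

theorem leftOrthogonal_quotient {K L X : 𝒜} {k : K ⟶ L} {p : L ⟶ X} {w : k ≫ p = 0}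
    (h : (ShortComplex.mk k p w).ShortExact) (hK : leftOrthogonal IsGorensteinInjective K)
    (hL : leftOrthogonal IsGorensteinInjective L) : leftOrthogonal IsGorensteinInjective X := by
  have : Mono k := h.mono_f
  have : Epi p := h.epi_g
  refine leftOrthogonal_of_lift fun {Y E Z j q w'} h' hE hY _ f => ?_
  obtain ⟨l, hl⟩ := (hL Y hY).exists_lift h' (p ≫ f)
  obtain ⟨a, ha⟩ := h'.exists_lift (k ≫ l) (by
    rw [Category.assoc, hl, ← Category.assoc, w, zero_comp])
  obtain ⟨Y', hY', E', j', q', w'', h'', hE'⟩ :=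
    isGorensteinInjectiveClass_isGorensteinInjective.left Y hY
  obtain ⟨b, hb⟩ := (hK Y' hY').exists_lift h'' a
  obtain ⟨d, hd⟩ := h.exists_desc (l - Injective.factorThru b k ≫ q' ≫ j) (by
    rw [Preadditive.comp_sub, ← Category.assoc k, Injective.comp_factorThru, reassoc_of% hb, ha,
      sub_self])
  refine ⟨d, ?_⟩
  rw [← cancel_epi p, ← Category.assoc, hd, Preadditive.sub_comp, hl]
  simp [w']

theorem leftOrthogonal_syzygy [EnoughInjectives 𝒜] {K P X : 𝒜} [Projective P] {k : K ⟶ P}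
    {p : P ⟶ X} {w : k ≫ p = 0} (h : (ShortComplex.mk k p w).ShortExact)
    (hX : leftOrthogonal IsGorensteinInjective X) : leftOrthogonal IsGorensteinInjective K := by
  refine leftOrthogonal_of_lift fun {Y E Z j q w'} h' hE _ hZ f => ?_
  have : Epi q := h'.epi_g
  obtain ⟨g, rfl⟩ := (hX Z hZ).exists_extension h f
  exact ⟨k ≫ Projective.factorThru g q, by rw [Category.assoc, Projective.factorThru_comp]⟩

end LeftOrthogonal

section Transfinite

theorem exists_wellFounded_rec {J : Type*} [LinearOrder J] [WellFoundedLT J] {C : J → Type*}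
    [∀ j, Nonempty (C j)] (Q : J → (∀ j, C j) → Prop)
    (hQ : ∀ j c c', (∀ k ≤ j, c k = c' k) → Q j c → Q j c')
    (hs : ∀ j c, (∀ k < j, Q k c) → ∃ x, Q j (Function.update c j x)) :
    ∃ c, ∀ j, Q j c := by
  classical
  have : ∀ j, Inhabited (C j) := fun j => Classical.inhabited_of_nonempty inferInstance
  let ext (j : J) (r : ∀ k, k < j → C k) : ∀ k, C k := fun k => if h : k < j then r k h else default
  let c : ∀ j, C j := wellFounded_lt.fix fun j r =>
    if h : ∃ x, Q j (Function.update (ext j r) j x) then h.choose else default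
  refine ⟨c, fun j => ?_⟩
  induction j using WellFoundedLT.induction with | _ j ih
  have hc : c j = if h : ∃ x, Q j (Function.update (ext j fun k _ => c k) j x) then h.choose
      else default := wellFounded_lt.fix_eq _ _
  have hlt : ∀ k < j, ext j (fun k _ => c k) k = c k := fun k hk => dif_pos hk
  have hex : ∃ x, Q j (Function.update (ext j fun k _ => c k) j x) :=
    hs j _ fun k hk => hQ k c _ (fun l hl => (hlt l (hl.trans_lt hk)).symm) (ih k hk)
  rw [dif_pos hex] at hc
  refine hQ j _ _ (fun k hk => ?_) hex.choose_spec
  rcases hk.lt_or_eq with hk | rfl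
  · rw [Function.update_of_ne hk.ne, hlt k hk]
  · rw [Function.update_self, hc]

universe w

variable {𝒜 : Type*} [Category 𝒜] [Abelian 𝒜] [IsGrothendieckAbelian.{w} 𝒜]

section Coboundary

variable {J : Type w} [LinearOrder J] (X : J ⥤ 𝒜) {E : 𝒜} (c : ∀ a : J, J → (X.obj a ⟶ E))
  (hc : ∀ {a b d : J} (h : a ≤ b) (_h' : b ≤ d), c a d = c a b + X.map (homOfLE h) ≫ c b d)

omit [IsGrothendieckAbelian.{w} 𝒜] in
include hc in
theorem cocycle_self (a : J) : c a a = 0 := by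
  have := hc le_rfl (le_refl a)
  rw [show homOfLE (le_refl a) = 𝟙 a from rfl, X.map_id, Category.id_comp] at this
  exact left_eq_add.1 this

omit [IsGrothendieckAbelian.{w} 𝒜] in
include hc in
/-- The extension of a functor by a constant functor defined by a cocycle. -/
theorem exists_cocycle_extension : ∃ (M : J ⥤ 𝒜) (i : ∀ a, E ⟶ M.obj a)
    (r : ∀ a, X.obj a ⟶ M.obj a), (∀ a, Mono (i a)) ∧
    (∀ {a b} (f : a ⟶ b), i a ≫ M.map f = i b) ∧
    ∀ {a b} (f : a ⟶ b), r a ≫ M.map f = c a b ≫ i b + X.map f ≫ r b := by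
  let M : J ⥤ 𝒜 :=
    { obj a := E ⊞ X.obj a
      map {a b} f := biprod.desc biprod.inl (c a b ≫ biprod.inl + X.map f ≫ biprod.inr)
      map_id a := by ext <;> simp [cocycle_self X c hc]
      map_comp {a b d} f g := by
        have := hc (leOfHom f) (leOfHom g)
        rw [show homOfLE (leOfHom f) = f from rfl] at this
        ext <;> simp [this] }
  exact ⟨M, fun a => (biprod.inl : E ⟶ E ⊞ X.obj a), fun a => (biprod.inr : X.obj a ⟶ E ⊞ X.obj a),
    fun a => (inferInstance : Mono (biprod.inl : E ⟶ E ⊞ X.obj a)),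
    fun f => biprod.inl_desc _ _, fun f => biprod.inr_desc _ _⟩

include hc in
theorem cocycle_eq_coboundary [Injective E] :
    ∃ b : ∀ a, X.obj a ⟶ E, ∀ {a d} (h : a ≤ d), c a d = X.map (homOfLE h) ≫ b d - b a := by
  rcases isEmpty_or_nonempty J with hJ | hJ
  · exact ⟨fun a => 0, fun {a} => hJ.elim a⟩
  obtain ⟨M, i, s, hi, him, hs⟩ := exists_cocycle_extension X c hc
  let φ : (Functor.const J).obj E ⟶ M :=
    { app := i
      naturality a b f := by simp [him] }
  have : ∀ a, Mono (φ.app a) := hi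
  have := NatTrans.mono_of_mono_app φ
  have : Mono (colim.map φ) := inferInstance
  let r : colimit M ⟶ E := Injective.factorThru
    (colimit.desc ((Functor.const J).obj E) ⟨E, ⟨fun _ => 𝟙 E, by simp⟩⟩) (colim.map φ)
  have hr : ∀ a, i a ≫ colimit.ι M a ≫ r = 𝟙 E := fun a => by
    have h1 : i a ≫ colimit.ι M a =
      colimit.ι ((Functor.const J).obj E) a ≫ colim.map φ := (ι_colimMap φ a).symm
    rw [← Category.assoc, h1, Category.assoc, Injective.comp_factorThru, colimit.ι_desc]
  refine ⟨fun a => - (s a ≫ colimit.ι M a ≫ r), fun {a d} h => ?_⟩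
  have h2 : s a ≫ colimit.ι M a ≫ r =
      c a d + X.map (homOfLE h) ≫ s d ≫ colimit.ι M d ≫ r := by
    rw [← colimit.w M (homOfLE h), Category.assoc, reassoc_of% hs (homOfLE h)]
    simp only [Preadditive.add_comp, Category.assoc, hr, Category.comp_id]
  dsimp only
  rw [h2]
  simp

end Coboundary

variable {J : Type w} [LinearOrder J] [WellFoundedLT J] (X : J ⥤ 𝒜)

omit [WellFoundedLT J] in
theorem cocycle_eq_coboundary_on (S : Set J) {E : 𝒜} [Injective E] (c : ∀ a : J, J → (X.obj a ⟶ E))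
    (hc : ∀ {a b d} (h : a ≤ b) (_ : b ≤ d), d ∈ S → a ∈ S → b ∈ S →
      c a d = c a b + X.map (homOfLE h) ≫ c b d) :
    ∃ b : ∀ a, X.obj a ⟶ E, ∀ {a d} (h : a ≤ d), d ∈ S → a ∈ S →
      c a d = X.map (homOfLE h) ≫ b d - b a := by
  classical
  obtain ⟨b, hb⟩ := cocycle_eq_coboundary ((Subtype.mono_coe (· ∈ S)).functor ⋙ X)
    (fun a b => c a.1 b.1) fun {a b d} h h' => hc h h' d.2 a.2 b.2
  have ⟨b', hb'⟩ : ∃ b' : ∀ a : S, X.obj a.1 ⟶ E, ∀ {a d : S} (h : a.1 ≤ d.1),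
    c a.1 d.1 = X.map (homOfLE h) ≫ b' d - b' a := ⟨b, hb⟩
  refine ⟨fun a => if h : a ∈ S then b' ⟨a, h⟩ else 0, fun {a d} h hd ha => ?_⟩
  simp only [dif_pos hd, dif_pos ha]
  exact hb' (a := ⟨a, ha⟩) (d := ⟨d, hd⟩) h

/-- Compatible families of morphisms on `S` to the target of `p` lift to the source of `p`. -/
def LiftsFamilies (S : Set J) {E G : 𝒜} (p : E ⟶ G) : Prop :=
  ∀ g : ∀ a, X.obj a ⟶ G, (∀ {a b} (h : a ≤ b), a ∈ S → b ∈ S → X.map (homOfLE h) ≫ g b = g a) →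
    ∃ e : ∀ a, X.obj a ⟶ E, (∀ a ∈ S, e a ≫ p = g a) ∧
      ∀ {a b} (h : a ≤ b), a ∈ S → b ∈ S → X.map (homOfLE h) ≫ e b = e a

/-- Cocycles lift along `p` if compatible families on all proper initial segments do. -/
theorem exists_cocycle_lift (S : Set J) {E G : 𝒜} [Injective E] (p : E ⟶ G)
    (hp : ∀ b ∈ S, LiftsFamilies X (Set.Iio b) p) (hS : ∀ {a b}, a ≤ b → b ∈ S → a ∈ S)
    (c : ∀ a : J, J → (X.obj a ⟶ G))
    (hc : ∀ {a b d} (h : a ≤ b) (_ : b ≤ d), d ∈ S →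
      c a d = c a b + X.map (homOfLE h) ≫ c b d) :
    ∃ c' : ∀ a : J, J → (X.obj a ⟶ E), (∀ {a b}, a ≤ b → b ∈ S → c' a b ≫ p = c a b) ∧
      ∀ {a b d} (h : a ≤ b) (_ : b ≤ d), d ∈ S →
        c' a d = c' a b + X.map (homOfLE h) ≫ c' b d := by
  classical
  have hcself : ∀ {a}, a ∈ S → c a a = 0 := fun {a} ha => by
    have := hc le_rfl (le_refl a) ha
    rw [show homOfLE (le_refl a) = 𝟙 a from rfl, X.map_id, Category.id_comp] at this
    exact left_eq_add.1 this
  have (_ : J) : Nonempty (∀ a : J, X.obj a ⟶ E) := ⟨fun _ => 0⟩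
  refine Exists.elim (exists_wellFounded_rec (C := fun _ : J => ∀ a : J, X.obj a ⟶ E)
    (fun d c' => d ∈ S → (∀ a ≤ d, c' d a ≫ p = c a d) ∧
      ∀ {a b} (h : a ≤ b) (_ : b ≤ d), c' d a = c' b a + X.map (homOfLE h) ≫ c' d b) ?_ ?_)
    fun c' hc' => ?_
  · intro d c₁ c₂ heq hQ hd
    refine ⟨fun a h => ?_, fun {a b} h h' => ?_⟩
    · rw [← heq d le_rfl, (hQ hd).1 a h]
    · rw [← heq d le_rfl, ← heq b h', (hQ hd).2 h h']
  · intro d c' ih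
    by_cases hd : d ∉ S
    · exact ⟨0, fun h => (hd h).elim⟩
    rw [not_not] at hd
    obtain ⟨b, hb⟩ := cocycle_eq_coboundary_on X (Set.Iio d) (fun x y => c' y x)
      fun {x y z} h h' hz _ _ => (ih z hz (hS (le_of_lt hz) hd)).2 h h'
    obtain ⟨y, hy, hy'⟩ := hp d hd (fun a => c a d + b a ≫ p) fun {x z} h hx hz => by
      have h1 := (ih z hz (hS (le_of_lt hz) hd)).1 x h
      rw [hb h hz hx, Preadditive.sub_comp, sub_eq_iff_eq_add, Category.assoc] at h1
      rw [Preadditive.comp_add, h1, hc h (le_of_lt hz) hd]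
      abel
    refine ⟨fun a => if a < d then y a - b a else 0, fun _ => ⟨fun a h => ?_,
      fun {x z} h h' => ?_⟩⟩
    · rw [Function.update_self]
      rcases h.lt_or_eq with h | rfl
      · rw [if_pos h, Preadditive.sub_comp, hy a h, add_sub_cancel_right]
      · rw [if_neg (lt_irrefl _), zero_comp, hcself hd]
    · rw [Function.update_self]
      rcases h'.lt_or_eq with h' | rfl
      · rw [Function.update_of_ne h'.ne, if_pos h', if_pos (h.trans_lt h'), Preadditive.comp_sub,
          hy' h (h.trans_lt h') h', hb h h' (h.trans_lt h')]
        abel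
      · rw [Function.update_self, if_neg (lt_irrefl _), comp_zero, add_zero]
  · exact ⟨fun a b => c' b a, fun {a b} h hb => (hc' b hb).1 a h,
      fun {a b d} h h' hd => (hc' d hd).2 h h'⟩

theorem liftsFamilies_of_initial (S : Set J) (hS : ∀ {a b}, a ≤ b → b ∈ S → a ∈ S)
    (hX : ∀ a, leftOrthogonal IsGorensteinInjective (X.obj a))
    (ih : ∀ b ∈ S, ∀ {Y E Z : 𝒜} {i : Y ⟶ E} {p : E ⟶ Z} {w : i ≫ p = 0},
      (ShortComplex.mk i p w).ShortExact → Injective E → IsGorensteinInjective Y →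
        LiftsFamilies X (Set.Iio b) p)
    {Y E Z : 𝒜} {i : Y ⟶ E} {p : E ⟶ Z} {w : i ≫ p = 0}
    (h : (ShortComplex.mk i p w).ShortExact) (hY : IsGorensteinInjective Y) :
    LiftsFamilies X S p := by
  intro g hg
  have hi : Mono i := h.mono_f
  have hlift : ∀ a, ∃ t : X.obj a ⟶ E, t ≫ p = g a := fun a => (hX a Y hY).exists_lift h (g a)
  choose t ht using hlift
  have hex : ∀ a b, ∃ c : X.obj a ⟶ Y, ∀ h : a ≤ b, b ∈ S →
      c ≫ i = X.map (homOfLE h) ≫ t b - t a := fun a b => by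
    by_cases hab : a ≤ b ∧ b ∈ S
    · obtain ⟨l, hl⟩ := h.exists_lift (X.map (homOfLE hab.1) ≫ t b - t a) (by
        rw [Preadditive.sub_comp, Category.assoc, ht, ht, hg hab.1 (hS hab.1 hab.2) hab.2,
          sub_self])
      exact ⟨l, fun _ _ => hl⟩
    · exact ⟨0, fun h h' => (hab ⟨h, h'⟩).elim⟩
  choose c hc using hex
  obtain ⟨Y', hY', E', i', p', w', h', hE'⟩ :=
    isGorensteinInjectiveClass_isGorensteinInjective.left Y hY
  obtain ⟨c', hc', hcc⟩ := exists_cocycle_lift X S p' (fun b hb => ih b hb h' hE' hY') hS c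
    fun {a b d} hab hbd hd => by
      rw [← cancel_mono i, Preadditive.add_comp, Category.assoc, hc _ _ (hab.trans hbd) hd,
        hc _ _ hab (hS hbd hd), hc _ _ hbd hd, ← homOfLE_comp hab hbd, X.map_comp,
        Preadditive.comp_sub, Category.assoc]
      abel
  obtain ⟨b, hb⟩ := cocycle_eq_coboundary_on X S c' fun h h' hd _ _ => hcc h h' hd
  refine ⟨fun a => t a - b a ≫ p' ≫ i, fun a _ => ?_, fun {x y} hxy hx hy => ?_⟩
  · rw [Preadditive.sub_comp, ht]
    simp [w]
  · have h1 := congr($(hc' hxy hy) ≫ i)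
    rw [hb hxy hy hx, hc _ _ hxy hy] at h1
    simp only [Preadditive.sub_comp, Category.assoc] at h1
    rw [Preadditive.comp_sub, sub_eq_sub_iff_sub_eq_sub, ← h1]

/-- The left orthogonal class of the Gorenstein injective objects is closed under colimits of
well-ordered systems. -/
theorem leftOrthogonal_of_isColimit (hX : ∀ a, leftOrthogonal IsGorensteinInjective (X.obj a))
    {c : Cocone X} (hc : IsColimit c) : leftOrthogonal IsGorensteinInjective c.pt := by
  have key : ∀ (b : J) {Y E Z : 𝒜} {i : Y ⟶ E} {p : E ⟶ Z} {w : i ≫ p = 0},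
      (ShortComplex.mk i p w).ShortExact → Injective E → IsGorensteinInjective Y →
        LiftsFamilies X (Set.Iio b) p := fun b => by
    induction b using WellFoundedLT.induction with | _ b ih
    intro Y E Z i p w h _ hY
    exact liftsFamilies_of_initial X _ (fun h h' => lt_of_le_of_lt h h') hX ih h hY
  refine leftOrthogonal_of_lift fun {Y E Z i p w} h _ hY _ f => ?_
  obtain ⟨e, he, he'⟩ := liftsFamilies_of_initial X Set.univ (fun _ _ => trivial) hX
    (fun b _ => key b) h hY (fun a => c.ι.app a ≫ f) fun h _ _ => by
      rw [← Category.assoc, c.w]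
  refine ⟨hc.desc ⟨E, { app := e, naturality := fun a b f => ?_ }⟩, hc.hom_ext fun a => ?_⟩
  · have := he' (leOfHom f) trivial trivial
    rw [show homOfLE (leOfHom f) = f from rfl] at this
    simpa using this
  · rw [hc.fac_assoc]
    exact he a trivial

end Transfinite

section Minimality

/-- Transfinite iteration of an endomap `toSucc`, as a functor on a well-ordered set. -/
theorem exists_transfinite_iteration {C : Type*} [Category C] (J : Type*) [LinearOrder J]
    [OrderBot J] [SuccOrder J] [WellFoundedLT J] [NoMaxOrder J] [HasIterationOfShape J C]
    (X₀ : C) (succ : C → C) (toSucc : ∀ X, X ⟶ succ X) :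
    ∃ F : J ⥤ C, Nonempty (X₀ ≅ F.obj ⊥) ∧
      ∀ j, ∃ e : succ (F.obj j) ≅ F.obj (Order.succ j),
        F.map (homOfLE (Order.le_succ j)) = toSucc _ ≫ e.hom := by
  let Φ : SmallObject.SuccStruct C := ⟨X₀, succ, toSucc⟩
  exact ⟨Φ.iterationFunctor J, ⟨(Φ.iterationFunctorObjBotIso J).symm⟩, fun j =>
    ⟨(Φ.iterationFunctorObjSuccIso j (not_isMax j)).symm,
      Φ.iterationFunctor_map_succ j (not_isMax j)⟩⟩

universe w

theorem exists_large_wellOrder (α : Type w) :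
    ∃ (J : Type w) (_ : LinearOrder J) (_ : WellFoundedLT J) (_ : OrderBot J) (_ : SuccOrder J),
      NoMaxOrder J ∧ ∀ f : J → α, ¬ Function.Injective f := by
  let κ : Cardinal.{w} := max Cardinal.aleph0 (Order.succ (Cardinal.mk α))
  have hκ : Cardinal.aleph0 ≤ κ := le_max_left _ _
  have := Cardinal.noMaxOrder hκ
  have : Nonempty κ.ord.ToType := by
    rw [← Cardinal.mk_ne_zero_iff, Cardinal.mk_ord_toType]
    exact (Cardinal.aleph0_pos.trans_le hκ).ne'
  refine ⟨κ.ord.ToType, inferInstance, inferInstance, WellFoundedLT.toOrderBot _,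
    SuccOrder.ofLinearWellFoundedLT _, inferInstance, fun f hf => ?_⟩
  have h := Cardinal.mk_le_of_injective hf
  rw [Cardinal.mk_ord_toType] at h
  exact absurd (h.trans_lt (Order.lt_succ _)) (not_lt.2 (le_max_right _ _))

theorem exists_wellOrder_subobject {𝒜 : Type*} [Category 𝒜] [Abelian 𝒜]
    [IsGrothendieckAbelian.{w} 𝒜] (A : 𝒜) :
    ∃ (J : Type w) (_ : LinearOrder J) (_ : WellFoundedLT J) (_ : OrderBot J) (_ : SuccOrder J),
      NoMaxOrder J ∧ ∀ s : J → Subobject A, ∃ i j, i < j ∧ s i = s j := by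
  obtain ⟨J, _, _, _, _, hJ, h⟩ := exists_large_wellOrder (Shrink.{w} (Subobject A))
  refine ⟨J, _, inferInstance, inferInstance, inferInstance, hJ, fun s => ?_⟩
  have := h (fun j => equivShrink _ (s j))
  rw [Function.not_injective_iff] at this
  obtain ⟨i, j, hij, hne⟩ := this
  have hij := (equivShrink _).injective hij
  rcases hne.lt_or_gt with h | h
  · exact ⟨i, j, h, hij⟩
  · exact ⟨j, i, h, hij.symm⟩

/-- A category has colimits of all nonempty well-ordered systems of size `w`. -/
def HasWellOrderedColimits (𝒯 : Type*) [Category 𝒯] : Prop :=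
  ∀ (J : Type w) [LinearOrder J] [WellFoundedLT J] [Nonempty J], HasColimitsOfShape J 𝒯

theorem HasWellOrderedColimits.hasIterationOfShape {𝒯 : Type*} [Category 𝒯]
    (h : HasWellOrderedColimits.{w} 𝒯) (J : Type w) [LinearOrder J] [WellFoundedLT J]
    [Nonempty J] : HasIterationOfShape J 𝒯 where
  hasColimitsOfShape := h J
  hasColimitsOfShape_of_isSuccLimit j hj := by
    have := hj.nonempty_Iio.to_subtype
    exact h _

theorem HasWellOrderedColimits.under {𝒯 : Type*} [Category 𝒯]
    (h : HasWellOrderedColimits.{w} 𝒯) (X : 𝒯) : HasWellOrderedColimits.{w} (Under X) := by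
  intro J _ _ _
  have := h J
  have : IsConnected J := IsFiltered.isConnected J
  exact Under.hasColimitsOfShape_of_isConnected

variable {𝒜 𝒯 : Type*} [Category 𝒜] [Abelian 𝒜] [IsGrothendieckAbelian.{w} 𝒜] [Category 𝒯]
  (U : 𝒯 ⥤ 𝒜)

/-- Every object has a map to another one whose kernel cannot be enlarged by further
composition. -/
theorem exists_kernel_stable (h𝒯 : HasWellOrderedColimits.{w} 𝒯) (T : 𝒯) :
    ∃ (X : 𝒯) (f : T ⟶ X), ∀ (Y : 𝒯) (g : X ⟶ Y) (A : 𝒜) (k : A ⟶ U.obj T),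
      k ≫ U.map (f ≫ g) = 0 → k ≫ U.map f = 0 := by
  by_contra! H
  have H' : ∀ X : Under T, ∃ (Y : 𝒯) (g : X.right ⟶ Y) (A : 𝒜) (k : A ⟶ U.obj T),
    k ≫ U.map (X.hom ≫ g) = 0 ∧ k ≫ U.map X.hom ≠ 0 := fun X => H X.right X.hom
  choose Y g A k hk hk' using H'
  obtain ⟨J, _, _, _, _, _, hJ⟩ := exists_wellOrder_subobject (U.obj T)
  have := (h𝒯.under T).hasIterationOfShape J
  obtain ⟨F, -, hF⟩ := exists_transfinite_iteration J (Under.mk (𝟙 T))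
    (fun X => Under.mk (X.hom ≫ g X)) (fun X => Under.homMk (g X))
  have hmono : ∀ {i j : J}, i ≤ j → kernelSubobject (U.map (F.obj i).hom) ≤
      kernelSubobject (U.map (F.obj j).hom) := fun {i j} hij => by
    rw [← Under.w (F.map (homOfLE hij)), U.map_comp]
    exact kernelSubobject_comp_le _ _
  obtain ⟨i, j, hij, hs⟩ := hJ fun j => kernelSubobject (U.map (F.obj j).hom)
  refine hk' (F.obj i) ?_
  rw [← kernelSubobject_factors_iff]
  refine Subobject.factors_of_le _ ((hmono (Order.succ_le_of_lt hij)).trans_eq hs.symm) ?_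
  rw [kernelSubobject_factors_iff]
  obtain ⟨e, -⟩ := hF i
  have he := Under.w e.hom
  dsimp at he
  rw [← he, U.map_comp]
  rw [reassoc_of% hk (F.obj i), zero_comp]

theorem mono_of_isColimit {J : Type w} [LinearOrder J] [Nonempty J] {D : J ⥤ 𝒜} {c : Cocone D}
    (hc : IsColimit c) {Z : 𝒜} (g : c.pt ⟶ Z)
    (hg : ∀ (j : J) (A : 𝒜) (k : A ⟶ D.obj j), k ≫ c.ι.app j ≫ g = 0 → k ≫ c.ι.app j = 0) :
    Mono g := by
  let φ : D ⟶ (Functor.const J).obj Z :=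
    { app := fun j => c.ι.app j ≫ g
      naturality := fun i j f => by simp }
  have hS : (ShortComplex.mk (kernel.ι φ) φ (kernel.condition φ)).Exact :=
    ShortComplex.exact_kernel φ
  have : IsConnected J := IsFiltered.isConnected J
  have h := colim.exact_mapShortComplex hS (colimit.isColimit _) hc
    (isColimitConstCocone J Z) 0 g (fun j => by
      have h1 := congr_app (kernel.condition φ) j
      rw [NatTrans.comp_app] at h1
      have h2 := hg j _ _ h1
      dsimp
      rw [comp_zero, h2]) (fun j => (Category.comp_id _).symm)
  exact h.mono_g rfl

/-- Every object maps to one all of whose outgoing maps are monomorphisms. -/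
theorem exists_mono_stable (h𝒯 : HasWellOrderedColimits.{w} 𝒯)
    (hU : ∀ (J : Type w) [LinearOrder J] [WellFoundedLT J] [Nonempty J],
      PreservesColimitsOfShape J U) (T : 𝒯) :
    ∃ (X : 𝒯) (_ : T ⟶ X), ∀ (Y : 𝒯) (g : X ⟶ Y), Mono (U.map g) := by
  choose S s hs using exists_kernel_stable U h𝒯
  obtain ⟨J, _, _, _, _, _, -⟩ := exists_large_wellOrder PUnit.{w + 1}
  have := h𝒯.hasIterationOfShape J
  obtain ⟨F, ⟨e₀⟩, hF⟩ := exists_transfinite_iteration J T S s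
  have := hU J
  refine ⟨colimit F, e₀.hom ≫ colimit.ι F ⊥, fun Y g => ?_⟩
  refine mono_of_isColimit (isColimitOfPreserves U (colimit.isColimit F)) (U.map g)
    fun j A k hk => ?_
  obtain ⟨e, he⟩ := hF j
  have hw : colimit.ι F j = s _ ≫ e.hom ≫ colimit.ι F (Order.succ j) := by
    rw [← colimit.w F (homOfLE (Order.le_succ j)), he, Category.assoc]
  have hk' : k ≫ U.map (colimit.ι F j) ≫ U.map g = 0 := hk
  change k ≫ U.map (colimit.ι F j) = 0
  rw [hw, U.map_comp, reassoc_of% hs (F.obj j) _ (e.hom ≫ colimit.ι F (Order.succ j) ≫ g) _ k ?_,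
    zero_comp]
  rw [← hk', ← U.map_comp, hw]
  simp only [Category.assoc]

/-- A weakly terminal object can be chosen such that all its endomorphisms are isomorphisms. -/
theorem exists_minimal_weaklyTerminal (h𝒯 : HasWellOrderedColimits.{w} 𝒯)
    (hU : ∀ (J : Type w) [LinearOrder J] [WellFoundedLT J] [Nonempty J],
      PreservesColimitsOfShape J U) (T₀ : 𝒯) (hT₀ : ∀ X, Nonempty (X ⟶ T₀)) :
    ∃ T : 𝒯, (∀ X, Nonempty (X ⟶ T)) ∧ ∀ f : T ⟶ T, IsIso (U.map f) := by
  obtain ⟨T, t, hT⟩ := exists_mono_stable U h𝒯 hU T₀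
  have hwt : ∀ X, Nonempty (X ⟶ T) := fun X => (hT₀ X).map (· ≫ t)
  refine ⟨T, hwt, fun f => ?_⟩
  have := hT T f
  suffices Epi (U.map f) from isIso_of_mono_of_epi _
  obtain ⟨J, _, _, _, _, _, hJ⟩ := exists_wellOrder_subobject (U.obj T)
  have := h𝒯.hasIterationOfShape J
  obtain ⟨F, -, hF⟩ := exists_transfinite_iteration J T (fun _ => T)
    fun X => (hwt X).some ≫ f
  choose e he using hF
  obtain ⟨q⟩ := hwt (colimit F)
  let m : ∀ j, F.obj (Order.succ j) ⟶ T := fun j => colimit.ι F _ ≫ q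
  have hm : ∀ j, Mono (U.map (m j)) := fun j => by
    have h1 : m j = (e j).inv ≫ ((e j).hom ≫ m j) := by simp
    have h2 := hT T ((e j).hom ≫ m j)
    rw [h1, U.map_comp]
    infer_instance
  obtain ⟨i, j, hij, hs⟩ := hJ fun j => Subobject.mk (U.map (m j))
  have hle : Order.succ i ≤ j := Order.succ_le_of_lt hij
  let d : F.obj (Order.succ i) ⟶ F.obj (Order.succ j) :=
    F.map (homOfLE (hle.trans (Order.le_succ j)))
  have hd : d ≫ m j = m i := by simp [d, m]
  have hiso : U.map d = (Subobject.isoOfMkEqMk _ _ hs).hom := by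
    rw [← cancel_mono (U.map (m j)), ← U.map_comp, hd]
    simp
  have hd' : d = (F.map (homOfLE hle) ≫ (hwt (F.obj j)).some) ≫ f ≫ (e j).hom := by
    have : d = F.map (homOfLE hle) ≫ F.map (homOfLE (Order.le_succ j)) := by
      rw [← F.map_comp]
      rfl
    rw [this, he]
    simp only [Category.assoc]
  have h1 : Epi (U.map (f ≫ (e j).hom)) := by
    have : Epi (U.map d) := by
      rw [hiso]
      infer_instance
    rw [hd', U.map_comp] at this
    exact epi_of_epi (U.map (F.map (homOfLE hle) ≫ (hwt (F.obj j)).some)) _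
  have h2 : U.map f = U.map (f ≫ (e j).hom) ≫ U.map (e j).inv := by
    rw [← U.map_comp]
    simp
  rw [h2]
  exact epi_comp _ _

end Minimality

section MinimalApproximations

universe w

/-- The class `Q` is closed under colimits of nonempty well-ordered systems of size `w`. -/
def ClosedUnderWellOrderedColimits {𝒯 : Type*} [Category 𝒯] (Q : 𝒯 → Prop) : Prop :=
  ∀ (J : Type w) [LinearOrder J] [WellFoundedLT J] [Nonempty J] (F : J ⥤ 𝒯) (c : Cocone F)
    (_ : IsColimit c), (∀ j, Q (F.obj j)) → Q c.pt

theorem exists_minimal_of_closedUnderWellOrderedColimits {𝒜 𝒯 : Type*} [Category 𝒜] [Abelian 𝒜]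
    [IsGrothendieckAbelian.{w} 𝒜] [Category 𝒯] (U : 𝒯 ⥤ 𝒜) [U.ReflectsIsomorphisms]
    (h𝒯 : HasWellOrderedColimits.{w} 𝒯)
    (hU : ∀ (J : Type w) [LinearOrder J] [WellFoundedLT J] [Nonempty J],
      PreservesColimitsOfShape J U) {Q : 𝒯 → Prop} (hQ : ClosedUnderWellOrderedColimits.{w} Q)
    (T₀ : 𝒯) (hQ₀ : Q T₀) (hT₀ : ∀ X, Q X → Nonempty (X ⟶ T₀)) :
    ∃ T : 𝒯, Q T ∧ (∀ X, Q X → Nonempty (X ⟶ T)) ∧ ∀ f : T ⟶ T, IsIso f := by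
  let P : ObjectProperty 𝒯 := Q
  have hP : ∀ (J : Type w) [LinearOrder J] [WellFoundedLT J] [Nonempty J],
      P.IsClosedUnderColimitsOfShape J := fun J _ _ _ => ⟨by
    rintro X ⟨p⟩
    exact hQ J p.diag p.cocone p.isColimit p.prop_diag_obj⟩
  obtain ⟨T, hT, hT'⟩ := exists_minimal_weaklyTerminal (P.ι ⋙ U)
    (fun J _ _ _ => by
      have := h𝒯 J
      have := hP J
      infer_instance)
    (fun J _ _ _ => by
      have := h𝒯 J
      have := hP J
      have := hU J
      infer_instance) ⟨T₀, hQ₀⟩ (fun X => (hT₀ X.obj X.property).map fun f => ObjectProperty.homMk f)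
  refine ⟨T.obj, T.property, fun X hX => (hT ⟨X, hX⟩).map fun f => f.hom, fun f => ?_⟩
  have : IsIso (U.map f) := hT' (ObjectProperty.homMk f)
  exact isIso_of_reflects_iso f U

variable {𝒜 : Type*} [Category 𝒜] [Abelian 𝒜] [IsGrothendieckAbelian.{w} 𝒜]

theorem hasWellOrderedColimits : HasWellOrderedColimits.{w} 𝒜 := fun _ _ _ _ => inferInstance

/-- Precovers by a class closed under well-ordered colimits can be refined to covers. -/
theorem IsPrecover.exists_isCover {W : 𝒜 → Prop} (hW : ClosedUnderWellOrderedColimits.{w} W)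
    {L X : 𝒜} {φ : L ⟶ X} (hφ : IsPrecover W φ) : ∃ (L' : 𝒜) (φ' : L' ⟶ X), IsCover W φ' := by
  obtain ⟨T, hT, hwt, hiso⟩ := exists_minimal_of_closedUnderWellOrderedColimits (Over.forget X)
    (fun _ _ _ _ => inferInstance) (fun _ _ _ _ => inferInstance)
    (Q := fun Y : Over X => W Y.left)
    (fun J _ _ _ F c hc hF => hW J _ _ (isColimitOfPreserves (Over.forget X) hc) hF)
    (Over.mk φ) hφ.1 (fun Y hY => by
      obtain ⟨h, hh⟩ := hφ.2 Y.left hY Y.hom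
      exact ⟨Over.homMk h hh⟩)
  refine ⟨T.left, T.hom, ⟨hT, fun G hG ψ => ?_⟩, fun f hf => ?_⟩
  · obtain ⟨h⟩ := hwt (Over.mk ψ) hG
    exact ⟨h.left, Over.w h⟩
  · have := hiso (Over.homMk f hf)
    exact inferInstanceAs (IsIso ((Over.forget X).map (Over.homMk f hf : T ⟶ T)))

/-- The monomorphisms out of `X` with cokernel in a class closed under well-ordered colimits are
closed under well-ordered colimits. -/
theorem closedUnderWellOrderedColimits_under {W : 𝒜 → Prop}
    (hW : ClosedUnderWellOrderedColimits.{w} W) (X : 𝒜) :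
    ClosedUnderWellOrderedColimits.{w}
      (fun Y : Under X => Mono Y.hom ∧ W (cokernel Y.hom)) := by
  intro J _ _ _ F c hc hF
  have : IsConnected J := IsFiltered.isConnected J
  have hc' := isColimitOfPreserves (Under.forget X) hc
  have hw : ∀ j, (F.obj j).hom ≫ (c.ι.app j).right = c.pt.hom := fun j => Under.w _
  have hw' : ∀ {i j : J} (f : i ⟶ j), (F.obj i).hom ≫ (F.map f).right = (F.obj j).hom :=
    fun f => Under.w _
  constructor
  · let φ : (Functor.const J).obj X ⟶ F ⋙ Under.forget X :=
      { app := fun j => (F.obj j).hom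
        naturality := fun i j f => by
          dsimp
          rw [hw' f, Category.id_comp] }
    have : ∀ j, Mono (φ.app j) := fun j => (hF j).1
    have := NatTrans.mono_of_mono_app φ
    exact colim.map_mono' φ (isColimitConstCocone J X) hc' c.pt.hom
      fun j => (Category.id_comp _).trans (hw j).symm
  · let D : J ⥤ 𝒜 :=
      { obj := fun j => cokernel (F.obj j).hom
        map := fun {i j} f => cokernel.map _ _ (𝟙 X) (F.map f).right
          (by rw [hw' f, Category.id_comp])
        map_id := fun j => by
          rw [← cancel_epi (cokernel.π _)]
          simp
        map_comp := fun f g => by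
          rw [← cancel_epi (cokernel.π _)]
          simp }
    let d : Cocone D :=
      { pt := cokernel c.pt.hom
        ι :=
          { app := fun j => cokernel.map _ _ (𝟙 X) (c.ι.app j).right
              (by rw [hw j, Category.id_comp])
            naturality := fun i j f => by
              rw [← cancel_epi (cokernel.π _)]
              have : (F.map f).right ≫ (c.ι.app j).right = (c.ι.app i).right :=
                congr_arg Under.Hom.right (c.w f)
              simp [D, reassoc_of% this] } }
    have hdesc : ∀ s : Cocone D, ∃ m : c.pt.right ⟶ s.pt, ∀ j,
        (c.ι.app j).right ≫ m = cokernel.π (F.obj j).hom ≫ s.ι.app j := fun s => by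
      let t : Cocone (F ⋙ Under.forget X) :=
        { pt := s.pt
          ι :=
            { app := fun j => cokernel.π (F.obj j).hom ≫ s.ι.app j
              naturality := fun i j f => by
                have := s.w f
                dsimp [D] at this ⊢
                rw [← this]
                simp } }
      exact ⟨hc'.desc t, hc'.fac t⟩
    have hext : ∀ {A : 𝒜} (m m' : c.pt.right ⟶ A),
        (∀ j, (c.ι.app j).right ≫ m = (c.ι.app j).right ≫ m') → m = m' :=
      fun m m' h => hc'.hom_ext h
    choose m hm using hdesc
    have hd : IsColimit d :=
      { desc := fun s => cokernel.desc _ (m s) (by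
          obtain ⟨j⟩ := ‹Nonempty J›
          rw [← hw j, Category.assoc, hm, cokernel.condition_assoc, zero_comp])
        fac := fun s j => by
          rw [← cancel_epi (cokernel.π _)]
          simp [d, hm]
        uniq := fun s m' hm' => by
          rw [← cancel_epi (cokernel.π _), cokernel.π_desc]
          refine hext _ _ fun j => ?_
          rw [hm, ← hm' j]
          simp [d] }
    exact hW J D d hd fun j => (hF j).2

/-- A special preenvelope whose cokernel lies in a class closed under well-ordered colimits can be
refined to a minimal one. -/
theorem exists_minimal_mono {W : 𝒜 → Prop} (hW : ClosedUnderWellOrderedColimits.{w} W)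
    {X G : 𝒜} (ψ : X ⟶ G) [Mono ψ] (hψ : W (cokernel ψ)) (hG : rightOrthogonal W G) :
    ∃ (G' : 𝒜) (ψ' : X ⟶ G') (_ : Mono ψ'), W (cokernel ψ') ∧ rightOrthogonal W G' ∧
      ∀ f : G' ⟶ G', ψ' ≫ f = ψ' → IsIso f := by
  have hext : ∀ {Y : 𝒜} (k : X ⟶ Y) [Mono k], W (cokernel k) → ∃ g, k ≫ g = ψ := fun k _ hk =>
    (hG _ hk).exists_extension (shortExact_cokernel k) ψ
  obtain ⟨T, ⟨hT, hTW⟩, hwt, hiso⟩ := exists_minimal_of_closedUnderWellOrderedColimits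
    (Under.forget X) (hasWellOrderedColimits.under X)
    (fun J _ _ _ => by
      have : IsConnected J := IsFiltered.isConnected J
      infer_instance)
    (closedUnderWellOrderedColimits_under hW X) (Under.mk ψ) ⟨‹_›, hψ⟩
    (fun Y ⟨hY, hY'⟩ => by
      obtain ⟨g, hg⟩ := hext Y.hom hY'
      exact ⟨Under.homMk g hg⟩)
  refine ⟨T.right, T.hom, hT, hTW, fun Z hZ => ?_, fun f hf => ?_⟩
  · obtain ⟨a⟩ := hwt (Under.mk ψ) ⟨‹_›, hψ⟩
    obtain ⟨b, hb⟩ := hext T.hom hTW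
    have := hiso ((Under.homMk b hb : T ⟶ Under.mk ψ) ≫ a)
    refine (hG Z hZ).of_retract b (a.right ≫
      (inv ((Under.homMk b hb : T ⟶ Under.mk ψ) ≫ a)).right) ?_
    exact (Category.assoc _ _ _).symm.trans (congr_arg Under.Hom.right
      (IsIso.hom_inv_id ((Under.homMk b hb : T ⟶ Under.mk ψ) ≫ a)))
  · have := hiso (Under.homMk f hf)
    exact inferInstanceAs (IsIso ((Under.forget X).map (Under.homMk f hf : T ⟶ T)))

end MinimalApproximations

section CoversAndEnvelopes

universe w

variable {𝒜 : Type*} [Category 𝒜] [Abelian 𝒜]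

/-- Short exact sequences push out along arbitrary morphisms from the left-hand term. -/
theorem shortExact_pushout {Y M Z L : 𝒜} {i : Y ⟶ M} {p : M ⟶ Z} {w : i ≫ p = 0}
    (h : (ShortComplex.mk i p w).ShortExact) (f : Y ⟶ L) :
    (ShortComplex.mk (pushout.inr i f) (pushout.desc p (0 : L ⟶ Z) (by rw [w, comp_zero]))
      (pushout.inr_desc _ _ _)).ShortExact := by
  have : Mono i := h.mono_f
  have hp : Epi p := h.epi_g
  have hpd := pushout.inl_desc p (0 : L ⟶ Z) (by rw [w, comp_zero] : i ≫ p = f ≫ 0)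
  have hepi : Epi (pushout.desc p (0 : L ⟶ Z) (by rw [w, comp_zero] : i ≫ p = f ≫ 0)) := by
    rw [← hpd] at hp
    exact epi_of_epi (pushout.inl i f) _
  exact
    { exact := ShortComplex.exact_of_g_is_cokernel _ (CokernelCofork.IsColimit.ofπ' _ _
        fun {A} k hk => by
          have hk' : pushout.inr i f ≫ k = 0 := hk
          have hex := h.exists_desc (pushout.inl i f ≫ k) (by
            rw [← Category.assoc, pushout.condition, Category.assoc, hk', comp_zero])
          refine ⟨hex.choose, pushout.hom_ext ?_ ?_⟩
          · rw [← Category.assoc, hpd, hex.choose_spec]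
          · rw [← Category.assoc, pushout.inr_desc, zero_comp, hk'])
      mono_f := inferInstanceAs (Mono (pushout.inr i f))
      epi_g := hepi }

theorem leftOrthogonal_of_iso {𝒞 : 𝒜 → Prop} {X X' : 𝒜} (e : X ≅ X')
    (hX : leftOrthogonal 𝒞 X) : leftOrthogonal 𝒞 X' := fun Y hY E i p w h => by
  obtain ⟨g, hg⟩ := (hX Y hY).exists_lift h e.hom
  exact ⟨e.inv ≫ g, by rw [Category.assoc, hg, e.inv_hom_id]⟩

theorem leftOrthogonal_cokernel {𝒞 : 𝒜 → Prop} {A B C : 𝒜} {i : A ⟶ B} {p : B ⟶ C}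
    {w : i ≫ p = 0} (h : (ShortComplex.mk i p w).ShortExact) (hC : leftOrthogonal 𝒞 C) :
    leftOrthogonal 𝒞 (cokernel i) :=
  leftOrthogonal_of_iso (IsColimit.coconePointUniqueUpToIso h.gIsCokernel (colimit.isColimit _)) hC

omit [Abelian 𝒜] in
theorem isIso_comp_inv_of_comp_eq {X Y : 𝒜} {φ : X ⟶ Y} {a : X ⟶ X} [IsIso a]
    (ha : a ≫ φ = φ) : inv a ≫ φ = φ := by
  rw [IsIso.inv_comp_eq, ha]

variable [EnoughProjectives 𝒜]

theorem IsCover.epi {𝒞 : 𝒜 → Prop} {L X : 𝒜} {φ : L ⟶ X}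
    (hφ : IsCover (leftOrthogonal 𝒞) φ) : Epi φ := by
  obtain ⟨h, hh⟩ := hφ.1.2 (Projective.over X) leftOrthogonal_of_projective (Projective.π X)
  have : Epi (h ≫ φ) := hh ▸ inferInstance
  exact epi_of_epi h φ

omit [EnoughProjectives 𝒜] in
/-- Wakamatsu's lemma for covers. -/
theorem IsCover.rightOrthogonal_kernel {L X : 𝒜} {φ : L ⟶ X}
    (hφ : IsCover (leftOrthogonal IsGorensteinInjective) φ) :
    rightOrthogonal (leftOrthogonal IsGorensteinInjective) (kernel φ) := by
  intro Z hZ M i q w h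
  obtain ⟨t, ht⟩ := hφ.1.2 _ (leftOrthogonal_of_extension (shortExact_pushout h (kernel.ι φ))
    hφ.1.1 hZ) (pushout.desc 0 φ (by simp))
  have ha : (pushout.inr i (kernel.ι φ) ≫ t) ≫ φ = φ := by
    rw [Category.assoc, ht, pushout.inr_desc]
  have := hφ.2 _ ha
  have hinv := isIso_comp_inv_of_comp_eq ha
  let r : M ⟶ L := pushout.inl i (kernel.ι φ) ≫ t ≫ inv (pushout.inr i (kernel.ι φ) ≫ t)
  have hr : r ≫ φ = 0 := by
    simp only [r, Category.assoc]
    rw [hinv, ht, pushout.inl_desc]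
  refine exists_section_of_retraction h (kernel.lift φ r hr) ?_
  rw [← cancel_mono (kernel.ι φ), Category.assoc, kernel.lift_ι, Category.id_comp]
  simp only [r]
  rw [← Category.assoc, pushout.condition, Category.assoc, ← Category.assoc (pushout.inr _ _),
    IsIso.hom_inv_id, Category.comp_id]

variable [EnoughInjectives 𝒜]

/-- If every object has a special precover by the left orthogonal class of the Gorenstein
injective objects, then the right orthogonal of that class consists of Gorenstein injective
objects. -/
theorem isGorensteinInjective_of_rightOrthogonal
    (H : ∀ X : 𝒜, ∃ (L : 𝒜) (φ : L ⟶ X), IsCover (leftOrthogonal IsGorensteinInjective) φ)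
    {G : 𝒜} (hG : rightOrthogonal (leftOrthogonal IsGorensteinInjective) G) :
    IsGorensteinInjective G := by
  refine IsGorensteinInjectiveClass.isGorensteinInjective ⟨fun I G hI hG =>
    hG I leftOrthogonal_of_injective, fun G hG => ?_, fun G hG => ?_⟩ hG
  · obtain ⟨L, φ, hφ⟩ := H G
    have := hφ.epi
    have hK := hφ.rightOrthogonal_kernel
    have hL := hφ.1.1
    have hL' : rightOrthogonal (leftOrthogonal IsGorensteinInjective) L := fun Z hZ =>
      (hK Z hZ).of_extension (shortExact_kernel φ) (hG Z hZ)
    have hι := shortExact_cokernel (Injective.ι L)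
    obtain ⟨r, hr⟩ := (hL' _ (leftOrthogonal_quotient hι hL
      leftOrthogonal_of_injective)).exists_extension hι (𝟙 L)
    refine ⟨kernel φ, hK, L, kernel.ι φ, φ, kernel.condition φ, shortExact_kernel φ,
      ⟨fun g f _ => ⟨Injective.factorThru (g ≫ Injective.ι L) f ≫ r, ?_⟩⟩⟩
    rw [← Category.assoc, Injective.comp_factorThru, Category.assoc, hr, Category.comp_id]
  · have hι := shortExact_cokernel (Injective.ι G)
    refine ⟨cokernel (Injective.ι G), fun Z hZ => ?_, _, _, _, _, hι, inferInstance⟩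
    have hπ := shortExact_kernel (Projective.π Z)
    refine ext1Zero_of_extension hπ fun f => ?_
    obtain ⟨g, rfl⟩ := (hG _ (leftOrthogonal_syzygy hπ hZ)).exists_lift hι f
    exact ⟨Injective.factorThru g (kernel.ι (Projective.π Z)) ≫ cokernel.π _, by
      rw [← Category.assoc, Injective.comp_factorThru]⟩

omit [EnoughProjectives 𝒜] [EnoughInjectives 𝒜] in
theorem closedUnderWellOrderedColimits_leftOrthogonal [IsGrothendieckAbelian.{w} 𝒜] :
    ClosedUnderWellOrderedColimits.{w} (leftOrthogonal (IsGorensteinInjective (𝒜 := 𝒜))) :=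
  fun _ _ _ _ F _ hc hF => leftOrthogonal_of_isColimit F hF hc

/-- If the left orthogonal of the Gorenstein injective objects is covering, the Gorenstein
injective objects are enveloping. -/
theorem exists_isEnvelope_of_covering [IsGrothendieckAbelian.{w} 𝒜]
    (H : ∀ X : 𝒜, ∃ (L : 𝒜) (φ : L ⟶ X), IsCover (leftOrthogonal IsGorensteinInjective) φ)
    (X : 𝒜) : ∃ (G : 𝒜) (ψ : X ⟶ G), IsEnvelope IsGorensteinInjective ψ := by
  have hι := shortExact_cokernel (Injective.ι X)
  obtain ⟨L, φ, hφ⟩ := H (cokernel (Injective.ι X))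
  have := hφ.epi
  have hX := shortExact_pullback hι φ
  have hG : rightOrthogonal (leftOrthogonal IsGorensteinInjective)
      (pullback (cokernel.π (Injective.ι X)) φ) := fun Z hZ =>
    ((hφ.rightOrthogonal_kernel Z hZ).of_extension
      (shortExact_pullback (shortExact_kernel φ) _) ext1Zero_of_injective).of_retract
      (pullbackSymmetry _ _).hom (pullbackSymmetry _ _).inv (Iso.hom_inv_id _)
  have : Mono _ := hX.mono_f
  obtain ⟨G, ψ, _, hψ, hG, hmin⟩ := exists_minimal_mono
    closedUnderWellOrderedColimits_leftOrthogonal.{w} _ (leftOrthogonal_cokernel hX hφ.1.1) hG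
  exact ⟨G, ψ, ⟨isGorensteinInjective_of_rightOrthogonal H hG, fun G' hG' f =>
    (hψ G' hG').exists_extension (shortExact_cokernel ψ) f⟩, hmin⟩

omit [EnoughProjectives 𝒜] in
theorem IsEnvelope.mono {X G : 𝒜} {φ : X ⟶ G} (hφ : IsEnvelope IsGorensteinInjective φ) :
    Mono φ := by
  obtain ⟨h, hh⟩ := hφ.1.2 (Injective.under X) isGorensteinInjective_of_injective (Injective.ι X)
  have : Mono (φ ≫ h) := hh ▸ inferInstance
  exact mono_of_mono φ h

omit [EnoughProjectives 𝒜] in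
/-- Wakamatsu's lemma for envelopes. -/
theorem IsEnvelope.leftOrthogonal_cokernel {X G : 𝒜} {φ : X ⟶ G}
    (hφ : IsEnvelope IsGorensteinInjective φ) :
    leftOrthogonal IsGorensteinInjective (cokernel φ) := by
  intro Y hY M i q w h
  obtain ⟨t, ht⟩ := hφ.1.2 _ (IsGorensteinInjective.of_extension
    (shortExact_pullback h (cokernel.π φ)) hY hφ.1.1) (pullback.lift 0 φ (by simp))
  have ha : φ ≫ t ≫ pullback.snd q (cokernel.π φ) = φ := by
    rw [← Category.assoc, ht, pullback.lift_snd]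
  have := hφ.2 _ ha
  have hinv : φ ≫ inv (t ≫ pullback.snd q (cokernel.π φ)) = φ := by
    rw [IsIso.comp_inv_eq, ha]
  refine ⟨cokernel.desc φ (inv (t ≫ pullback.snd q (cokernel.π φ)) ≫ t ≫ pullback.fst _ _) ?_, ?_⟩
  · rw [← Category.assoc, hinv, ← Category.assoc, ht, pullback.lift_fst]
  · rw [← cancel_epi (cokernel.π φ), ← Category.assoc, cokernel.π_desc, Category.comp_id,
      Category.assoc, Category.assoc, pullback.condition, ← Category.assoc t,
      IsIso.inv_hom_id_assoc]

/-- If the Gorenstein injective objects are enveloping, their left orthogonal is covering. -/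
theorem exists_isCover_of_enveloping [IsGrothendieckAbelian.{w} 𝒜]
    (H : ∀ X : 𝒜, ∃ (G : 𝒜) (ψ : X ⟶ G), IsEnvelope IsGorensteinInjective ψ)
    (X : 𝒜) : ∃ (L : 𝒜) (φ : L ⟶ X), IsCover (leftOrthogonal IsGorensteinInjective) φ := by
  have hπ := shortExact_kernel (Projective.π X)
  obtain ⟨G, ψ, hψ⟩ := H (kernel (Projective.π X))
  have := hψ.mono
  have hL := leftOrthogonal_of_extension
    (shortExact_pushout (shortExact_cokernel ψ) (kernel.ι (Projective.π X)))
    leftOrthogonal_of_projective hψ.leftOrthogonal_cokernel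
  have hX := shortExact_pushout hπ ψ
  exact IsPrecover.exists_isCover closedUnderWellOrderedColimits_leftOrthogonal.{w}
    ⟨leftOrthogonal_of_iso (pushoutSymmetry _ _) hL, fun L' hL' f =>
      (hL' G hψ.1.1).exists_lift hX f⟩

end CoversAndEnvelopes

section EnoughProjectives

variable {𝒜 : Type*} [Category 𝒜] [Abelian 𝒜] {ι : Type*} (c : ComplexShape ι) [c.HasNoLoop]

/-- Evaluation of complexes at a degree has a left adjoint. -/
theorem exists_universal_homologicalComplex (P : 𝒜) (j : ι) :
    ∃ (D : HomologicalComplex 𝒜 c) (x : P ⟶ D.X j), ∀ (K : HomologicalComplex 𝒜 c) (y : P ⟶ K.X j),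
      ∃! f : D ⟶ K, x ≫ f.f j = y := by
  classical
  have r := HomologicalComplex.evalCompCoyonedaCorepresentable c P j
  have hr : ∀ {K : HomologicalComplex 𝒜 c} (f : _ ⟶ K),
      r.homEquiv f = r.homEquiv (𝟙 _) ≫ f.f j := fun f => r.homEquiv_eq f
  refine ⟨_, r.homEquiv (𝟙 _), fun K y => ⟨r.homEquiv.symm y, ?_, fun f hf => ?_⟩⟩
  · exact (hr _).symm.trans (r.homEquiv.apply_symm_apply y)
  · exact r.homEquiv.injective (((hr f).trans hf).trans (r.homEquiv.apply_symm_apply y).symm)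

theorem homologicalComplex_enoughProjectives [EnoughProjectives 𝒜] [HasCoproductsOfShape ι 𝒜] :
    EnoughProjectives (HomologicalComplex 𝒜 c) where
  presentation X := by
    choose D x hD using fun j => exists_universal_homologicalComplex c (Projective.over (X.X j)) j
    have hproj : ∀ j, Projective (D j) := fun j =>
      { factors := fun {E Y} f e he => by
          have : Epi e := he
          have : Epi (e.f j) := inferInstance
          obtain ⟨g, hg, -⟩ := hD j E
            (Projective.factorThru (x j ≫ f.f j) (e.f j))
          refine ⟨g, (hD j Y (x j ≫ f.f j)).unique ?_ rfl⟩
          rw [HomologicalComplex.comp_f, ← Category.assoc, hg]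
          exact Projective.factorThru_comp _ _ }
    choose g hg _ using fun j => hD j X (Projective.π (X.X j))
    have hf : ∀ j, Epi ((Limits.Sigma.desc g).f j) := fun j => by
      have h : (x j ≫ (Limits.Sigma.ι D j).f j) ≫ (Limits.Sigma.desc g).f j = Projective.π (X.X j) := by
        rw [Category.assoc, ← HomologicalComplex.comp_f, Limits.Sigma.ι_desc]
        exact hg j
      have : Epi ((x j ≫ (Limits.Sigma.ι D j).f j) ≫ (Limits.Sigma.desc g).f j) := h ▸ inferInstance
      exact epi_of_epi (x j ≫ (Limits.Sigma.ι D j).f j) _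
    have : Epi (Limits.Sigma.desc g) := HomologicalComplex.epi_of_epi_f _ hf
    have : Projective (∐ D) :=
      { factors := fun f e _ => ⟨Limits.Sigma.desc fun j =>
          Projective.factorThru (Limits.Sigma.ι D j ≫ f) e, by cat_disch⟩ }
    exact ⟨{ p := ∐ D, f := Limits.Sigma.desc g }⟩

end EnoughProjectives

/-- Let `R` be a left noetherian ring and `GI(C)` the class of Gorenstein
injective complexes.  The following are equivalent: (1) the cotorsion pair `(⊥GI(C), GI(C))`
is perfect; (2) `⊥GI(C)` is covering; (3) `GI(C)` is enveloping. -/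
theorem gorensteinInjective_complexes_perfect_iff_covering_iff_enveloping
    (R : Type u) [Ring R] [IsNoetherianRing R] :
    (((∀ X : ChainComplex (ModuleCat.{u} R) ℤ, ∃ (L : ChainComplex (ModuleCat.{u} R) ℤ)
        (φ : L ⟶ X), IsCover (leftOrthogonal (fun K : ChainComplex (ModuleCat.{u} R) ℤ => IsGorensteinInjective K)) φ) ∧
      (∀ X : ChainComplex (ModuleCat.{u} R) ℤ, ∃ (G : ChainComplex (ModuleCat.{u} R) ℤ)
        (ψ : X ⟶ G), IsEnvelope (fun K : ChainComplex (ModuleCat.{u} R) ℤ => IsGorensteinInjective K) ψ)) ↔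
     (∀ X : ChainComplex (ModuleCat.{u} R) ℤ, ∃ (L : ChainComplex (ModuleCat.{u} R) ℤ)
        (φ : L ⟶ X), IsCover (leftOrthogonal (fun K : ChainComplex (ModuleCat.{u} R) ℤ => IsGorensteinInjective K)) φ)) ∧
    (((∀ X : ChainComplex (ModuleCat.{u} R) ℤ, ∃ (L : ChainComplex (ModuleCat.{u} R) ℤ)
        (φ : L ⟶ X), IsCover (leftOrthogonal (fun K : ChainComplex (ModuleCat.{u} R) ℤ => IsGorensteinInjective K)) φ) ∧
      (∀ X : ChainComplex (ModuleCat.{u} R) ℤ, ∃ (G : ChainComplex (ModuleCat.{u} R) ℤ)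
        (ψ : X ⟶ G), IsEnvelope (fun K : ChainComplex (ModuleCat.{u} R) ℤ => IsGorensteinInjective K) ψ)) ↔
     (∀ X : ChainComplex (ModuleCat.{u} R) ℤ, ∃ (G : ChainComplex (ModuleCat.{u} R) ℤ)
        (ψ : X ⟶ G), IsEnvelope (fun K : ChainComplex (ModuleCat.{u} R) ℤ => IsGorensteinInjective K) ψ)) := by
  have := homologicalComplex_enoughProjectives (𝒜 := ModuleCat.{u} R) (ComplexShape.down ℤ)
  have h₁ := exists_isEnvelope_of_covering.{u} (𝒜 := ChainComplex (ModuleCat.{u} R) ℤ)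
  have h₂ := exists_isCover_of_enveloping.{u} (𝒜 := ChainComplex (ModuleCat.{u} R) ℤ)
  exact ⟨⟨And.left, fun h => ⟨h, h₁ h⟩⟩, ⟨And.right, fun h => ⟨h₂ h, h⟩⟩⟩
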